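/- arXiv:2603.17245 — 3 statements merged into one kernel-verified Lean document; each statement's English description precedes it below -/
import Mathlib

section
/- Let n ≥ 1 and d ≥ 3, and let F be a homogeneous polynomial of degree d in S = ℂ[x_0,…,x_{n+1}] such that the only common zero of the partial derivatives ∂F/∂x_0,…,∂F/∂x_{n+1} in ℂ^{n+2} is the origin. Set σ = (n+2)(d−2). Then the Hilbert function of the Jacobian ring R(F) is strictly increasing up to the middle degree: for all natural numbers j < k with 2k ≤ σ, dim_ℂ R(F)_j < dim_ℂ R(F)_k. -/
noncomputable section

open MvPolynomial

/-- The Jacobian ideal of `F`, generated by the partial derivatives of `F`. -/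
def jacobianIdeal {N : ℕ} (F : MvPolynomial (Fin N) ℂ) : Ideal (MvPolynomial (Fin N) ℂ) :=
  Ideal.span (Set.range fun i => pderiv i F)

/-- The degree-`k` graded piece of the quotient `S ⧸ I`: the image of the homogeneous
polynomials of degree `k` under the quotient map. -/
def gradedPiece {N : ℕ} (I : Ideal (MvPolynomial (Fin N) ℂ)) (k : ℕ) :
    Submodule ℂ (MvPolynomial (Fin N) ℂ ⧸ I) :=
  (homogeneousSubmodule (Fin N) ℂ k).map (Ideal.Quotient.mkₐ ℂ I).toLinearMap

/-- Multiplication on `S ⧸ I` by the residue class of `g : S`. -/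
def mulMap {N : ℕ} (I : Ideal (MvPolynomial (Fin N) ℂ)) (g : MvPolynomial (Fin N) ℂ) :
    (MvPolynomial (Fin N) ℂ ⧸ I) →ₗ[ℂ] (MvPolynomial (Fin N) ℂ ⧸ I) :=
  LinearMap.mulLeft ℂ (Ideal.Quotient.mk I g)



namespace JacHilb

abbrev Sg (N : ℕ) := MvPolynomial (Fin N) ℂ

/-- homogeneous ideal -/
def HomI {N : ℕ} (I : Ideal (Sg N)) : Prop := ∀ p ∈ I, ∀ n, homogeneousComponent n p ∈ I

def Nzd {N : ℕ} (I : Ideal (Sg N)) (g : Sg N) : Prop := ∀ p, g * p ∈ I → p ∈ I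

def idl {N : ℕ} (f : Fin N → Sg N) (T : Finset (Fin N)) : Ideal (Sg N) :=
  Ideal.span (f '' (T : Set (Fin N)))

def Good {N : ℕ} (f : Fin N → Sg N) : Prop := ∀ T i, i ∉ T → Nzd (idl f T) (f i)

def Sop {N : ℕ} (f : Fin N → Sg N) : Prop := ∀ i, ∃ m : ℕ, (X i : Sg N) ^ m ∈ idl f Finset.univ

attribute [local instance] MvPolynomial.gradedAlgebra

lemma homI_idl {N e : ℕ} {f : Fin N → Sg N} (hf : ∀ i, (f i).IsHomogeneous e)
    (T : Finset (Fin N)) : HomI (idl f T) := by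
  intro p hp n
  refine homogeneousComponent_mem_of_mem (I := idl f T) ?_ hp n
  apply Ideal.homogeneous_span
  rintro x ⟨i, _, rfl⟩
  exact ⟨e, hf i⟩

lemma hc_mul {N e : ℕ} {a : Sg N} (ha : a.IsHomogeneous e) (q : Sg N) (k : ℕ) :
    homogeneousComponent (k + e) (a * q) = a * homogeneousComponent k q := by
  have hq := sum_homogeneousComponent q
  have h2 : ∀ (m : ℕ) (i : ℕ), homogeneousComponent (m + e) (a * homogeneousComponent i q) =
      a * homogeneousComponent m (homogeneousComponent i q) := by
    intro m i
    have hi := homogeneousComponent_isHomogeneous i q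
    have h3 : (a * homogeneousComponent i q).IsHomogeneous (i + e) := by
      rw [add_comm]; exact ha.mul hi
    rw [homogeneousComponent_of_mem h3, homogeneousComponent_of_mem hi]
    by_cases h : m = i <;> simp [h]
  rw [← hq, Finset.mul_sum, map_sum, map_sum, Finset.mul_sum]
  exact Finset.sum_congr rfl fun i _ => h2 k i

lemma hc_mul_lt {N e : ℕ} {a : Sg N} (ha : a.IsHomogeneous e) (q : Sg N) (k : ℕ) (hk : k < e) :
    homogeneousComponent k (a * q) = 0 := by
  have hq := sum_homogeneousComponent q
  rw [← hq, Finset.mul_sum, map_sum]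
  refine Finset.sum_eq_zero fun i _ => ?_
  have hi := homogeneousComponent_isHomogeneous i q
  rw [homogeneousComponent_of_mem (ha.mul hi), if_neg (by omega)]

lemma mem_of_hc {N : ℕ} {I : Ideal (Sg N)} {p : Sg N} (h : ∀ k, homogeneousComponent k p ∈ I) :
    p ∈ I := by
  rw [← sum_homogeneousComponent p]
  exact Ideal.sum_mem _ fun i _ => h i

lemma nzd_of_hom {N e : ℕ} {I : Ideal (Sg N)} {g : Sg N} (hI : HomI I) (hg : g.IsHomogeneous e)
    (h : ∀ k p, p.IsHomogeneous k → g * p ∈ I → p ∈ I) : Nzd I g := by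
  intro p hp
  refine mem_of_hc fun k => h k _ (homogeneousComponent_isHomogeneous k p) ?_
  rw [← hc_mul hg]
  exact hI _ hp _

lemma mem_span_sup {N : ℕ} {I : Ideal (Sg N)} {g p : Sg N} :
    p ∈ Ideal.span {g} ⊔ I ↔ ∃ q, ∃ u ∈ I, p = g * q + u := by
  rw [Submodule.mem_sup]
  constructor
  · rintro ⟨y, hy, z, hz, rfl⟩
    obtain ⟨q, rfl⟩ := Ideal.mem_span_singleton'.1 hy
    exact ⟨q, z, hz, by ring⟩
  · rintro ⟨q, u, hu, rfl⟩
    exact ⟨g * q, Ideal.mul_mem_right _ _ (Ideal.mem_span_singleton_self g), u, hu, rfl⟩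

/-- homogeneous version of membership in `(g) + I`. -/
lemma mem_span_sup_hom {N e : ℕ} {I : Ideal (Sg N)} {g p : Sg N} (hI : HomI I)
    (hg : g.IsHomogeneous e) {k : ℕ} (hp : p.IsHomogeneous k) (h : p ∈ Ideal.span {g} ⊔ I) :
    p ∈ I ∨ ∃ l, k = l + e ∧ ∃ q, q.IsHomogeneous l ∧ ∃ u ∈ I, u.IsHomogeneous k ∧
      p = g * q + u := by
  obtain ⟨q, u, hu, hpu⟩ := mem_span_sup.1 h
  have h1 : p = homogeneousComponent k (g * q) + homogeneousComponent k u := by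
    rw [← map_add, ← hpu, homogeneousComponent_eq_self hp]
  by_cases hk : k < e
  · left
    rw [hc_mul_lt hg q k hk, zero_add] at h1
    rw [h1]; exact hI _ hu _
  · right
    obtain ⟨l, rfl⟩ : ∃ l, k = l + e := ⟨k - e, by omega⟩
    rw [hc_mul hg] at h1
    exact ⟨l, rfl, _, homogeneousComponent_isHomogeneous l q, _, hI _ hu _,
      homogeneousComponent_isHomogeneous _ u, h1⟩

lemma nzd_descend {N e : ℕ} (he : 1 ≤ e) {I : Ideal (Sg N)} {a b : Sg N} (hI : HomI I)
    (ha : a.IsHomogeneous e) (hb : b.IsHomogeneous e)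
    (h1 : Nzd I a) (h2 : Nzd (Ideal.span {a} ⊔ I) b) : Nzd I b := by
  refine nzd_of_hom hI hb fun k => ?_
  induction k using Nat.strong_induction_on with
  | _ k ih =>
    intro p hp hbp
    have h3 := h2 p (Ideal.mem_sup_right hbp)
    rcases mem_span_sup_hom hI ha hp h3 with h | ⟨l, rfl, q, hq, u, hu, -, rfl⟩
    · exact h
    · have : b * q ∈ I := by
        apply h1
        have h4 : a * (b * q) = b * (a * q + u) - b * u := by ring
        rw [h4]
        exact sub_mem hbp (Ideal.mul_mem_left _ _ hu)
      exact add_mem (Ideal.mul_mem_left _ _ (ih l (by omega) q hq this)) hu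

lemma nzd_swap {N : ℕ} {I : Ideal (Sg N)} {a b : Sg N}
    (h1 : Nzd I a) (h2 : Nzd (Ideal.span {a} ⊔ I) b) : Nzd (Ideal.span {b} ⊔ I) a := by
  intro p hp
  obtain ⟨q, u, hu, h⟩ := mem_span_sup.1 hp
  have h3 : b * q ∈ Ideal.span {a} ⊔ I := mem_span_sup.2 ⟨p, -u, neg_mem hu, by rw [h]; ring⟩
  obtain ⟨r, v, hv, h4⟩ := mem_span_sup.1 (h2 _ h3)
  have h5 : p - b * r ∈ I := by
    apply h1
    have : a * (p - b * r) = b * v + u := by rw [mul_sub, h, h4]; ring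
    rw [this]
    exact add_mem (Ideal.mul_mem_left _ _ hv) hu
  exact mem_span_sup.2 ⟨r, _, h5, by ring⟩

lemma idl_insert {N : ℕ} (f : Fin N → Sg N) (T : Finset (Fin N)) (i : Fin N) :
    idl f (insert i T) = Ideal.span {f i} ⊔ idl f T := by
  rw [idl, idl, Finset.coe_insert, Set.image_insert_eq, Ideal.span_insert]

lemma idl_congr {N : ℕ} {f g : Fin N → Sg N} {T : Finset (Fin N)} (h : ∀ i ∈ T, f i = g i) :
    idl f T = idl g T := by
  rw [idl, idl, Set.image_congr (fun i hi => h i hi)]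

instance {N : ℕ} (k : ℕ) : Module.Finite ℂ (homogeneousSubmodule (Fin N) ℂ k) :=
  Module.Finite.iff_fg.2 (homogeneousSubmodule_fg _ _ k)

instance {N : ℕ} (I : Ideal (Sg N)) (k : ℕ) : Module.Finite ℂ (gradedPiece I k) := by
  unfold gradedPiece; infer_instance

lemma mk_mem {N : ℕ} (I : Ideal (Sg N)) {k : ℕ} {p : Sg N} (hp : p.IsHomogeneous k) :
    Ideal.Quotient.mk I p ∈ gradedPiece I k :=
  ⟨p, hp, rfl⟩

lemma mem_gp {N : ℕ} {I : Ideal (Sg N)} {k : ℕ} {x : Sg N ⧸ I} :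
    x ∈ gradedPiece I k ↔ ∃ p : Sg N, p.IsHomogeneous k ∧ Ideal.Quotient.mk I p = x :=
  Iff.rfl

/-- multiplication map on graded pieces -/
def mulG {N : ℕ} (I : Ideal (Sg N)) {e : ℕ} {g : Sg N} (hg : g.IsHomogeneous e) (k : ℕ) :
    gradedPiece I k →ₗ[ℂ] gradedPiece I (k + e) :=
  (mulMap I g).restrict (by
    rintro x ⟨p, hp, rfl⟩
    refine ⟨g * p, ?_, ?_⟩
    · rw [add_comm]; exact hg.mul hp
    · simp [mulMap])

lemma mulG_mk {N : ℕ} (I : Ideal (Sg N)) {e : ℕ} {g : Sg N} (hg : g.IsHomogeneous e) (k : ℕ)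
    {p : Sg N} (hp : p.IsHomogeneous k) :
    (mulG I hg k ⟨_, mk_mem I hp⟩ : Sg N ⧸ I) = Ideal.Quotient.mk I (g * p) := by
  simp [mulG, mulMap]

lemma mulG_inj {N : ℕ} {I : Ideal (Sg N)} {e : ℕ} {g : Sg N} (hg : g.IsHomogeneous e) (k : ℕ)
    (h : Nzd I g) : Function.Injective (mulG I hg k) := by
  rw [injective_iff_map_eq_zero]
  rintro ⟨x, p, hp, rfl⟩ hx
  have h1 := mulG_mk I hg k hp
  have h2 : Ideal.Quotient.mk I (g * p) = 0 := by
    rw [← h1]; exact congrArg Subtype.val hx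
  rw [Ideal.Quotient.eq_zero_iff_mem] at h2
  ext
  exact Ideal.Quotient.eq_zero_iff_mem.2 (h p h2)

lemma nzd_key {N e : ℕ} (he : 1 ≤ e) {I : Ideal (Sg N)} {a b : Sg N} (hI : HomI I)
    (ha : a.IsHomogeneous e) (hb : b.IsHomogeneous e) (h1 : Nzd I a) (K : ℕ)
    (hK : ∀ k, K ≤ k → ∀ p : Sg N, p.IsHomogeneous k → p ∈ Ideal.span {b} ⊔ I) : Nzd I b := by
  have hinj : ∀ k, K ≤ k → Function.Injective (mulG I hb k) := by
    intro k hk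
    have hs : Function.Surjective (mulG I hb k) := by
      rintro ⟨x, p, hp, rfl⟩
      rcases mem_span_sup_hom hI hb hp (hK _ (by omega) p hp) with h | ⟨l, hl, q, hq, u, hu, -, h⟩
      · refine ⟨0, ?_⟩
        ext
        simpa using (Ideal.Quotient.eq_zero_iff_mem.2 h).symm
      · obtain rfl : k = l := by omega
        refine ⟨⟨_, mk_mem I hq⟩, ?_⟩
        ext
        rw [mulG_mk _ _ _ hq]
        refine Ideal.Quotient.eq.2 ?_
        rw [h]; simpa using hu
    have h3 := LinearMap.finrank_le_finrank_of_injective (mulG_inj ha k h1)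
    have h4 := LinearMap.finrank_le_finrank_of_surjective hs
    exact (LinearMap.injective_iff_surjective_of_finrank_eq_finrank (le_antisymm h3 h4)).2 hs
  have hbig : ∀ k, K ≤ k → ∀ p : Sg N, p.IsHomogeneous k → b * p ∈ I → p ∈ I := by
    intro k hk p hp hbp
    have : (⟨_, mk_mem I hp⟩ : gradedPiece I k) = 0 := by
      apply hinj k hk
      rw [map_zero]
      ext
      rw [mulG_mk _ _ _ hp]
      exact Ideal.Quotient.eq_zero_iff_mem.2 hbp
    exact Ideal.Quotient.eq_zero_iff_mem.1 (congrArg Subtype.val this)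
  have hpow : ∀ m p, a ^ m * p ∈ I → p ∈ I := by
    intro m
    induction m with
    | zero => intro p hp; simpa using hp
    | succ m ih =>
      intro p hp
      refine ih p (h1 _ ?_)
      rwa [← mul_assoc, ← pow_succ']
  refine nzd_of_hom hI hb fun k p hp hbp => ?_
  apply hpow K
  have hd : (a ^ K * p).IsHomogeneous (e * K + k) := (ha.pow K).mul hp
  refine hbig _ ?_ _ hd ?_
  · nlinarith
  · have : b * (a ^ K * p) = a ^ K * (b * p) := by ring
    rw [this]
    exact Ideal.mul_mem_left _ _ hbp

lemma large_of_pow {N : ℕ} {I : Ideal (Sg N)} (h : ∀ i, ∃ m : ℕ, (X i : Sg N) ^ m ∈ I) :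
    ∃ K, ∀ k, K ≤ k → ∀ p : Sg N, p.IsHomogeneous k → p ∈ I := by
  choose m hm using h
  refine ⟨(∑ i, m i) + 1, fun k hk p hp => ?_⟩
  rw [p.as_sum]
  refine Ideal.sum_mem _ fun s hs => ?_
  have hdeg : s.degree = k := by
    have := hp (mem_support_iff.1 hs)
    rwa [Finsupp.degree_eq_weight_one]
  obtain ⟨i, hi⟩ : ∃ i, m i ≤ s i := by
    by_contra! hcon
    have h1 : ∑ i, s i ≤ ∑ i, m i := Finset.sum_le_sum fun i _ => (hcon i).le
    rw [Finsupp.degree_eq_sum] at hdeg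
    omega
  have : monomial s (coeff s p) = X i ^ m i * monomial (s - Finsupp.single i (m i)) (coeff s p) := by
    rw [X_pow_eq_monomial, monomial_mul, one_mul, add_tsub_cancel_of_le]
    simpa using hi
  rw [this]
  exact Ideal.mul_mem_right _ _ (hm i)

lemma exchange {N e : ℕ} (he : 1 ≤ e) {a : Fin N → Sg N} (ha : ∀ i, (a i).IsHomogeneous e)
    (hG : Good a) (i₀ : Fin N) {b : Sg N} (hb : b.IsHomogeneous e)
    (hS : Sop (Function.update a i₀ b)) : Good (Function.update a i₀ b) := by
  have hup : ∀ T, i₀ ∉ T → idl (Function.update a i₀ b) T = idl a T := fun T hT =>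
    idl_congr fun i hi => Function.update_of_ne (by rintro rfl; exact hT hi) _ _
  obtain ⟨K, hK⟩ := large_of_pow hS
  -- b is nzd modulo every subset of the others
  have hbn : ∀ T : Finset (Fin N), i₀ ∉ T → Nzd (idl a T) b := by
    have : ∀ (c : ℕ) (T : Finset (Fin N)), i₀ ∉ T → (insert i₀ T)ᶜ.card = c →
        Nzd (idl a T) b := by
      intro c
      induction c with
      | zero =>
        intro T hT hc
        have hT' : insert i₀ T = Finset.univ := by
          rwa [Finset.card_eq_zero, Finset.compl_eq_empty_iff] at hc
        refine nzd_key he (homI_idl ha T) (ha i₀) hb (hG T i₀ hT) K fun k hk p hp => ?_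
        have := hK k hk p hp
        rw [← hT', idl_insert, hup T hT, Function.update_self] at this
        exact this
      | succ c ih =>
        intro T hT hc
        obtain ⟨j, hj⟩ : (insert i₀ T)ᶜ.Nonempty := by
          rw [← Finset.card_pos]; omega
        have hj' : j ≠ i₀ ∧ j ∉ T := by simpa using hj
        refine nzd_descend he (homI_idl ha T) (ha j) hb (hG T j hj'.2) ?_
        rw [← idl_insert]
        refine ih _ (by simp [hT, hj'.1.symm]) ?_
        rw [Finset.insert_comm, Finset.compl_insert, Finset.card_erase_of_mem hj, hc]
        rfl
    exact fun T hT => this _ T hT rfl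
  intro T i hi
  by_cases hT : i₀ ∈ T
  · have hne : i ≠ i₀ := by rintro rfl; exact hi hT
    rw [Function.update_of_ne hne, ← Finset.insert_erase hT, idl_insert, Function.update_self,
      hup _ (Finset.notMem_erase _ _)]
    have hi' : i ∉ T.erase i₀ := fun h => hi (Finset.mem_of_mem_erase h)
    refine nzd_swap (hG _ i hi') ?_
    rw [← idl_insert]
    exact hbn _ (by simp [hne.symm])
  · rw [hup T hT]
    by_cases h : i = i₀
    · subst h; rw [Function.update_self]; exact hbn T hT
    · rw [Function.update_of_ne h]; exact hG T i hi

lemma chain {N e : ℕ} (he : 1 ≤ e) {u w : Fin N → Sg N} (hu : ∀ i, (u i).IsHomogeneous e)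
    (hw : ∀ i, (w i).IsHomogeneous e) (hG : Good u)
    (hS : ∀ r : ℕ, Sop (fun j => if j.val < r then w j else u j)) : Good w := by
  have : ∀ r : ℕ, r ≤ N → Good (fun j : Fin N => if j.val < r then w j else u j) := by
    intro r
    induction r with
    | zero => intro _; simpa using hG
    | succ r ih =>
      intro hr
      have heq : (fun j : Fin N => if j.val < r + 1 then w j else u j) =
          Function.update (fun j : Fin N => if j.val < r then w j else u j) ⟨r, hr⟩ (w ⟨r, hr⟩) := by
        funext j
        by_cases hj : j = ⟨r, hr⟩
        · subst hj; simp
        · rw [Function.update_of_ne hj]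
          have : j.val ≠ r := fun h => hj (Fin.ext h)
          have : (j.val < r + 1) ↔ j.val < r := by omega
          simp [this]
      have h1 := hS (r + 1)
      rw [heq] at h1 ⊢
      refine exchange he (fun i => ?_) (ih (by omega)) _ (hw _) h1
      split_ifs
      · exact hw i
      · exact hu i
  simpa using this N le_rfl

lemma idl_univ {N : ℕ} (f : Fin N → Sg N) : idl f Finset.univ = Ideal.span (Set.range f) := by
  simp [idl]

lemma pencil {N e : ℕ} {u v : Fin N → Sg N} (hu : ∀ i, (u i).IsHomogeneous e)
    (hv : ∀ i, (v i).IsHomogeneous e) (hS : Sop u) :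
    {t : ℂ | ¬ Sop (fun i => u i + t • v i)}.Finite := by
  obtain ⟨k, hk⟩ := large_of_pow hS
  replace hk := hk k le_rfl
  let ev : (Fin N → Sg N) → (Fin N → Sg N) →ₗ[ℂ] Sg N := fun w =>
    ∑ i, (LinearMap.mulRight ℂ (w i)) ∘ₗ LinearMap.proj i
  have hev : ∀ w q, ev w q = ∑ i, q i * w i := by intro w q; simp [ev]
  let b := Module.finBasis ℂ (homogeneousSubmodule (Fin N) ℂ k)
  have hex : ∀ j, ∃ q : Fin N → Sg N, ev u q = (b j : Sg N) := by
    intro j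
    have h1 := hk (b j) (b j).2
    rw [idl_univ, Ideal.mem_span_range_iff_exists_fun] at h1
    obtain ⟨c, hc⟩ := h1
    exact ⟨c, by rw [hev, hc]⟩
  choose q hq using hex
  let Q := b.constr ℂ q
  have hQ : ∀ x, ev u (Q x) = (x : Sg N) := by
    have : ev u ∘ₗ Q = Submodule.subtype _ := by
      refine b.ext fun j => ?_
      simp [Q, hq]
    intro x
    exact congrArg (fun l => l x) this
  let B : Module.End ℂ (homogeneousSubmodule (Fin N) ℂ k) :=
    LinearMap.codRestrict _ (homogeneousComponent k ∘ₗ ev v ∘ₗ Q)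
      (fun x => homogeneousComponent_mem k _)
  have hB : ∀ x, ((B x : homogeneousSubmodule (Fin N) ℂ k) : Sg N) =
    homogeneousComponent k (ev v (Q x)) := fun x => rfl
  refine ((B.finite_hasEigenvalue).image (fun μ => -μ⁻¹)).subset ?_
  intro t ht
  by_contra hcon
  apply ht
  have hinj : Function.Injective (1 + t • B : Module.End ℂ (homogeneousSubmodule (Fin N) ℂ k)) := by
    rw [injective_iff_map_eq_zero]
    intro x hx
    by_contra hx0
    have hx' : x + t • B x = 0 := by simpa using hx
    have ht0 : t ≠ 0 := by
      rintro rfl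
      simp at hx'
      exact hx0 hx'
    refine hcon ⟨-t⁻¹, ?_, by simp⟩
    refine Module.End.hasEigenvalue_of_hasEigenvector (x := x) ⟨?_, hx0⟩
    rw [Module.End.mem_eigenspace_iff]
    have h2 : t • B x = -x := by rw [eq_neg_iff_add_eq_zero, add_comm]; exact hx'
    rw [neg_smul, ← smul_neg, ← h2, smul_smul, inv_mul_cancel₀ ht0, one_smul]
  have hsurj := LinearMap.surjective_of_injective hinj
  have hw : ∀ i, (u i + t • v i).IsHomogeneous e := fun i =>
    (homogeneousSubmodule (Fin N) ℂ e).add_mem (hu i)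
      ((homogeneousSubmodule (Fin N) ℂ e).smul_mem t (hv i))
  intro i
  refine ⟨k, ?_⟩
  obtain ⟨x, hx⟩ := hsurj ⟨X i ^ k, isHomogeneous_X_pow i k⟩
  have hx2 : (x : Sg N) + t • homogeneousComponent k (ev v (Q x)) = X i ^ k := by
    have := congrArg Subtype.val hx
    simpa [hB] using this
  have hx3 : homogeneousComponent k (ev (fun i => u i + t • v i) (Q x)) = X i ^ k := by
    rw [← hx2]
    have h4 : ev (fun i => u i + t • v i) (Q x) = ev u (Q x) + t • ev v (Q x) := by
      simp [hev, mul_add, Finset.sum_add_distrib, Finset.smul_sum]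
    rw [h4, map_add, map_smul, hQ, homogeneousComponent_eq_self x.2]
  rw [← hx3]
  refine homI_idl hw _ _ ?_ k
  rw [hev]
  refine Ideal.sum_mem _ fun j _ => Ideal.mul_mem_left _ _ (Ideal.subset_span ⟨j, by simp, rfl⟩)

lemma good_of_sop {N e : ℕ} (he : 1 ≤ e) {a f : Fin N → Sg N} (ha : ∀ i, (a i).IsHomogeneous e)
    (hf : ∀ i, (f i).IsHomogeneous e) (hGa : Good a) (hSa : Sop a) (hSf : Sop f) : Good f := by
  have hadd : ∀ {p q : Sg N}, p.IsHomogeneous e → q.IsHomogeneous e → (p + q).IsHomogeneous e :=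
    fun hp hq => (homogeneousSubmodule (Fin N) ℂ e).add_mem hp hq
  have hsub : ∀ {p q : Sg N}, p.IsHomogeneous e → q.IsHomogeneous e → (p - q).IsHomogeneous e :=
    fun hp hq => (homogeneousSubmodule (Fin N) ℂ e).sub_mem hp hq
  have hsm : ∀ {p : Sg N} (t : ℂ), p.IsHomogeneous e → (t • p).IsHomogeneous e :=
    fun t hp => (homogeneousSubmodule (Fin N) ℂ e).smul_mem t hp
  have hz : (0 : Sg N).IsHomogeneous e := (homogeneousSubmodule (Fin N) ℂ e).zero_mem
  -- directions
  let vA : ℕ → Fin N → Sg N := fun r j => if j.val < r then f j - a j else 0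
  let vB : ℕ → Fin N → Sg N := fun r j => if j.val < r then 0 else a j - f j
  have hvA : ∀ r j, (vA r j).IsHomogeneous e := by
    intro r j; dsimp only [vA]; split_ifs
    · exact hsub (hf j) (ha j)
    · exact hz
  have hvB : ∀ r j, (vB r j).IsHomogeneous e := by
    intro r j; dsimp only [vB]; split_ifs
    · exact hz
    · exact hsub (ha j) (hf j)
  have hfin : ((⋃ r ∈ Finset.range (N + 1), {t : ℂ | ¬ Sop (fun i => a i + t • vA r i)}) ∪
      (⋃ r ∈ Finset.range (N + 1),
        (fun t => 1 - t) '' {t : ℂ | ¬ Sop (fun i => f i + t • vB r i)})).Finite := by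
    refine Set.Finite.union ?_ ?_
    · exact Set.Finite.biUnion (Finset.finite_toSet _) fun r _ => pencil ha (hvA r) hSa
    · exact Set.Finite.biUnion (Finset.finite_toSet _) fun r _ =>
        (pencil hf (hvB r) hSf).image _
  obtain ⟨t, ht⟩ := hfin.infinite_compl.nonempty
  simp only [Set.compl_union, Set.mem_inter_iff, Set.mem_compl_iff, Set.mem_iUnion, not_exists,
    Set.mem_image, Set.mem_ofPred_eq, not_and, not_not, Finset.mem_range] at ht
  obtain ⟨htA, htB⟩ := ht
  let w : Fin N → Sg N := fun j => a j + t • (f j - a j)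
  have hw : ∀ j, (w j).IsHomogeneous e := fun j => hadd (ha j) (hsm t (hsub (hf j) (ha j)))
  have hcap : ∀ (x y : Fin N → Sg N) (r : ℕ),
      (fun j : Fin N => if j.val < r then x j else y j) =
      (fun j : Fin N => if j.val < min r N then x j else y j) := by
    intro x y r; funext j
    have : j.val < min r N ↔ j.val < r := by have := j.2; omega
    simp [this]
  have hGw : Good w := by
    refine chain he ha hw hGa fun r => ?_
    rw [hcap]
    have := htA (min r N) (by omega)
    convert! this using 2 with j
    dsimp only [vA, w]
    split_ifs <;> simp
  refine chain he hw hf hGw fun r => ?_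
  rw [hcap]
  have : Sop (fun i => f i + (1 - t) • vB (min r N) i) := by
    by_contra hc
    exact htB (min r N) (by omega) _ hc (by ring)
  convert! this using 2 with j
  dsimp only [vB, w]
  split_ifs
  · simp
  · module

lemma good_X_pow {N : ℕ} (e : ℕ) : Good (fun i : Fin N => (X i : Sg N) ^ e) := by
  intro T i hi p hp
  have hid : idl (fun i : Fin N => (X i : Sg N) ^ e) T =
      Ideal.span ((fun s => monomial s (1 : ℂ)) '' ((fun j => Finsupp.single j e) '' (T : Set (Fin N)))) := by
    rw [idl, Set.image_image]
    simp only [X_pow_eq_monomial]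
  rw [hid, mem_ideal_span_monomial_image] at hp ⊢
  intro s hs
  obtain ⟨_, ⟨j, hj, rfl⟩, h⟩ := hp (Finsupp.single i e + s) (by
    rw [mem_support_iff] at hs ⊢
    show coeff _ (X i ^ e * p) ≠ 0
    rwa [X_pow_eq_monomial, coeff_monomial_mul, one_mul])
  refine ⟨_, ⟨j, hj, rfl⟩, ?_⟩
  have hne : i ≠ j := by rintro rfl; exact hi hj
  simp only [Finsupp.single_le_iff, Finsupp.add_apply, Finsupp.single_eq_of_ne' hne, zero_add] at h ⊢
  exact h

lemma sop_X_pow {N : ℕ} (e : ℕ) : Sop (fun i : Fin N => (X i : Sg N) ^ e) :=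
  fun i => ⟨e, Ideal.subset_span ⟨i, by simp, rfl⟩⟩

def hf {N : ℕ} (I : Ideal (Sg N)) (k : ℕ) : ℕ := Module.finrank ℂ (gradedPiece I k)

def proj {N : ℕ} {I J : Ideal (Sg N)} (h : I ≤ J) (k : ℕ) :
    gradedPiece I k →ₗ[ℂ] (Sg N ⧸ J) :=
  (Ideal.Quotient.factorₐ ℂ h).toLinearMap ∘ₗ (gradedPiece I k).subtype

lemma proj_mk {N : ℕ} {I J : Ideal (Sg N)} (h : I ≤ J) (k : ℕ) {p : Sg N}
    (hp : p.IsHomogeneous k) : proj h k ⟨_, mk_mem I hp⟩ = Ideal.Quotient.mk J p := rfl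

lemma proj_range {N : ℕ} {I J : Ideal (Sg N)} (h : I ≤ J) (k : ℕ) :
    LinearMap.range (proj h k) = gradedPiece J k := by
  ext x
  constructor
  · rintro ⟨⟨y, p, hp, rfl⟩, rfl⟩
    exact mk_mem J hp
  · rintro ⟨p, hp, rfl⟩
    exact ⟨⟨_, mk_mem I hp⟩, rfl⟩

lemma hf_add_ker {N : ℕ} {I J : Ideal (Sg N)} (h : I ≤ J) (k : ℕ) :
    hf J k + Module.finrank ℂ (LinearMap.ker (proj h k)) = hf I k := by
  rw [hf, ← proj_range h k]
  exact LinearMap.finrank_range_add_finrank_ker _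

lemma hf_step {N e : ℕ} {I : Ideal (Sg N)} {g : Sg N} (hI : HomI I) (hg : g.IsHomogeneous e)
    (hz : Nzd I g) (k : ℕ) : hf (Ideal.span {g} ⊔ I) (k + e) + hf I k = hf I (k + e) := by
  rw [← hf_add_ker (le_sup_right : I ≤ Ideal.span {g} ⊔ I) (k + e)]
  congr 1
  rw [hf, ← LinearMap.finrank_range_of_inj (mulG_inj hg k hz)]
  suffices hs : LinearMap.range (mulG I hg k) =
      LinearMap.ker (proj (le_sup_right : I ≤ Ideal.span {g} ⊔ I) (k + e)) by rw [hs]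
  ext x
  constructor
  · rintro ⟨⟨y, p, hp, rfl⟩, rfl⟩
    have hgp : (g * p).IsHomogeneous (k + e) := by rw [add_comm]; exact hg.mul hp
    rw [LinearMap.mem_ker]
    have h1 : mulG I hg k ⟨_, mk_mem I hp⟩ =
        ⟨_, mk_mem I hgp⟩ := by
      ext; exact mulG_mk I hg k hp
    refine (congrArg _ h1).trans ?_
    rw [proj_mk _ _ hgp]
    exact Ideal.Quotient.eq_zero_iff_mem.2
      (mem_span_sup.2 ⟨p, 0, zero_mem _, by ring⟩)
  · intro hx
    obtain ⟨y, p, hp, rfl⟩ := x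
    have h1 : p ∈ Ideal.span {g} ⊔ I := Ideal.Quotient.eq_zero_iff_mem.1 hx
    rcases mem_span_sup_hom hI hg hp h1 with h | ⟨l, hl, q, hq, u, hu, -, h⟩
    · refine ⟨0, ?_⟩
      ext
      simpa using (Ideal.Quotient.eq_zero_iff_mem.2 h).symm
    · obtain rfl : k = l := by omega
      refine ⟨⟨_, mk_mem I hq⟩, ?_⟩
      ext
      rw [mulG_mk _ _ _ hq]
      refine Ideal.Quotient.eq.2 ?_
      rw [h]; simpa using hu

lemma hf_lt {N e : ℕ} {I : Ideal (Sg N)} {g : Sg N} (hI : HomI I) (hg : g.IsHomogeneous e)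
    (k : ℕ) (hk : k < e) : hf (Ideal.span {g} ⊔ I) k = hf I k := by
  rw [← hf_add_ker (le_sup_right : I ≤ Ideal.span {g} ⊔ I) k]
  have : LinearMap.ker (proj (le_sup_right : I ≤ Ideal.span {g} ⊔ I) k) = ⊥ := by
    rw [LinearMap.ker_eq_bot']
    rintro ⟨y, p, hp, rfl⟩ hx
    have h1 : p ∈ Ideal.span {g} ⊔ I := Ideal.Quotient.eq_zero_iff_mem.1 hx
    rcases mem_span_sup_hom hI hg hp h1 with h | ⟨l, hl, -⟩
    · ext
      simpa using (Ideal.Quotient.eq_zero_iff_mem.2 h)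
    · omega
  rw [this, finrank_bot, add_zero]

def Hs {N : ℕ} (I : Ideal (Sg N)) : PowerSeries ℤ := PowerSeries.mk fun k => (hf I k : ℤ)

lemma Hs_step {N e : ℕ} {I : Ideal (Sg N)} {g : Sg N} (hI : HomI I) (hg : g.IsHomogeneous e)
    (hz : Nzd I g) : Hs (Ideal.span {g} ⊔ I) = Hs I * (1 - PowerSeries.X ^ e) := by
  ext k
  rw [mul_sub, mul_one, map_sub, PowerSeries.coeff_mul_X_pow']
  simp only [Hs, PowerSeries.coeff_mk]
  split_ifs with h
  · obtain ⟨l, rfl⟩ : ∃ l, k = l + e := ⟨k - e, by omega⟩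
    rw [← hf_step hI hg hz l]
    simp
  · rw [hf_lt hI hg k (by omega), sub_zero]

lemma Hs_good {N e : ℕ} {f : Fin N → Sg N} (hf : ∀ i, (f i).IsHomogeneous e) (hG : Good f)
    (T : Finset (Fin N)) :
    Hs (idl f T) = Hs (⊥ : Ideal (Sg N)) * (1 - PowerSeries.X ^ e) ^ T.card := by
  induction T using Finset.induction_on with
  | empty => simp [idl]
  | insert i T hi ih =>
    rw [idl_insert, Hs_step (homI_idl hf T) (hf i) (hG T i hi), ih, Finset.card_insert_of_notMem hi,
      pow_succ, mul_assoc]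

lemma Hs_X {N : ℕ} : Hs (idl (fun i : Fin N => (X i : Sg N) ^ 1) Finset.univ) = 1 := by
  ext k
  rw [PowerSeries.coeff_one, Hs, PowerSeries.coeff_mk, hf]
  set I := idl (fun i : Fin N => (X i : Sg N) ^ 1) Finset.univ with hIdef
  have hI1 : (1 : Sg N) ∉ I := by
    intro h
    have hle : I ≤ RingHom.ker (constantCoeff (σ := Fin N) (R := ℂ)) := by
      rw [hIdef, idl, Ideal.span_le]
      rintro x ⟨i, -, rfl⟩
      simp
    have := hle h
    simp at this
  by_cases hk : k = 0
  · subst hk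
    rw [if_pos rfl]
    norm_cast
    rw [finrank_eq_one_iff']
    refine ⟨⟨_, mk_mem I (isHomogeneous_one (Fin N) ℂ)⟩, ?_, ?_⟩
    · intro h
      exact hI1 (Ideal.Quotient.eq_zero_iff_mem.1 (congrArg Subtype.val h))
    · rintro ⟨y, p, hp, rfl⟩
      refine ⟨coeff 0 p, ?_⟩
      ext
      have h1 : p = C (coeff 0 p) := by
        rw [← homogeneousComponent_zero, homogeneousComponent_eq_self hp]
      have h2 : coeff 0 p • (1 : Sg N) = p := by
        rw [smul_eq_C_mul, mul_one, ← h1]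
      show coeff 0 p • Ideal.Quotient.mk I 1 = Ideal.Quotient.mk I p
      conv_rhs => rw [← h2]
      rfl
  · rw [if_neg hk]
    norm_cast
    have : gradedPiece I k = ⊥ := by
      rw [eq_bot_iff]
      rintro x ⟨p, hp, rfl⟩
      refine Ideal.Quotient.eq_zero_iff_mem.2 ?_
      have hI2 : I = Ideal.span (X '' (Set.univ : Set (Fin N))) := by simp [hIdef, idl]
      rw [hI2, mem_ideal_span_X_image]
      intro m hm
      have hdeg : m.degree = k := by
        have := hp (mem_support_iff.1 hm)
        rwa [Finsupp.degree_eq_weight_one]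
      by_contra! hcon
      apply hk
      rw [← hdeg, Finsupp.degree_eq_sum]
      exact Finset.sum_eq_zero fun i _ => hcon i (Set.mem_univ i)
    rw [this, finrank_bot]

lemma Hs_sop {N e : ℕ} (he : 1 ≤ e) {f : Fin N → Sg N} (hf : ∀ i, (f i).IsHomogeneous e)
    (hS : Sop f) : Hs (idl f Finset.univ) = (∑ i ∈ Finset.range e, PowerSeries.X ^ i) ^ N := by
  have hG := good_of_sop he (fun i => isHomogeneous_X_pow i e) hf (good_X_pow e) (sop_X_pow e) hS
  have h1 := Hs_good (e := 1) (fun i => isHomogeneous_X_pow i 1) (good_X_pow (N := N) 1) Finset.univ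
  rw [Hs_X] at h1
  rw [Hs_good hf hG]
  simp only [Finset.card_univ, Fintype.card_fin, pow_one] at h1 ⊢
  rw [← mul_neg_geom_sum, mul_pow, ← mul_assoc, ← h1, one_mul]

/-- coefficients of `(1 + t + ... + t^(e-1))^N`, indexed by integers -/
def cf (e : ℕ) : ℕ → ℤ → ℤ
  | 0, k => if k = 0 then 1 else 0
  | N + 1, k => ∑ i ∈ Finset.range e, cf e N (k - i)

lemma cf_neg (e N : ℕ) (k : ℤ) (hk : k < 0) : cf e N k = 0 := by
  induction N generalizing k with
  | zero => simp [cf, hk.ne]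
  | succ N ih => exact Finset.sum_eq_zero fun i _ => ih _ (by omega)

lemma cf_coeff (e N k : ℕ) :
    PowerSeries.coeff k ((∑ i ∈ Finset.range e, (PowerSeries.X : PowerSeries ℤ) ^ i) ^ N)
      = cf e N k := by
  induction N generalizing k with
  | zero => simp [cf, PowerSeries.coeff_one]
  | succ N ih =>
    rw [pow_succ, Finset.mul_sum, map_sum, cf]
    refine Finset.sum_congr rfl fun i _ => ?_
    rw [PowerSeries.coeff_mul_X_pow']
    split_ifs with h
    · rw [ih]; congr 1; omega
    · rw [cf_neg]; omega

lemma cf_symm (e : ℕ) (he : 1 ≤ e) (N : ℕ) (k : ℤ) : cf e N (N * (e - 1) - k) = cf e N k := by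
  induction N generalizing k with
  | zero => simp [cf]
  | succ N ih =>
    rw [cf, cf, ← Finset.sum_range_reflect]
    refine Finset.sum_congr rfl fun i hi => ?_
    rw [← ih]
    congr 1
    have := Finset.mem_range.1 hi
    have h2 : ((e - 1 - i : ℕ) : ℤ) = e - 1 - i := by omega
    rw [h2]; push_cast; ring

lemma cf_diff (e N : ℕ) (k : ℤ) : cf e (N + 1) k - cf e (N + 1) (k - 1) =
    cf e N k - cf e N (k - e) := by
  rw [cf, cf, ← Finset.sum_sub_distrib]
  have := Finset.sum_range_sub' (fun i : ℕ => cf e N (k - i)) e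
  simp only [Nat.cast_zero, sub_zero] at this
  rw [← this]
  refine Finset.sum_congr rfl fun i _ => ?_
  congr 2; push_cast; ring

def StrictP (e N : ℕ) : Prop := ∀ k : ℤ, 0 ≤ k → 2 * k ≤ N * (e - 1) → cf e N (k - 1) < cf e N k

lemma mono_of_strict {e N : ℕ} (h : StrictP e N) {i j : ℤ} (hij : i < j) (hj : 0 ≤ j)
    (hj2 : 2 * j ≤ N * (e - 1)) : cf e N i < cf e N j := by
  have hm : ∀ m : ℕ, ∀ j : ℤ, 2 * j ≤ N * (e - 1) → cf e N (j - m) ≤ cf e N j := by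
    intro m
    induction m with
    | zero => intro j _; simp
    | succ m ih =>
      intro j hj
      have h1 := ih (j - 1) (by linarith)
      have h2 : cf e N (j - 1) ≤ cf e N j := by
        by_cases h0 : 0 ≤ j
        · exact (h j h0 hj).le
        · rw [cf_neg e N j (by omega), cf_neg e N (j - 1) (by omega)]
      have h3 : j - ((m + 1 : ℕ) : ℤ) = j - 1 - m := by push_cast; ring
      rw [h3]; exact h1.trans h2
  have h1 := hm (j - 1 - i).toNat (j - 1) (by linarith)
  have h2 : j - 1 - ((j - 1 - i).toNat : ℤ) = i := by omega
  rw [h2] at h1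
  exact h1.trans_lt (h j hj hj2)

def QP (e N : ℕ) : Prop := ∀ i j : ℤ, i + e ≤ j → i + j < N * (e - 1) → 0 ≤ j → j ≤ N * (e - 1) →
  cf e N i < cf e N j

lemma qp_of_strict {e N : ℕ} (he : 1 ≤ e) (h : StrictP e N) : QP e N := by
  intro i j h1 h2 h3 h4
  by_cases hj : 2 * j ≤ N * (e - 1)
  · exact mono_of_strict h (by omega) h3 hj
  · rw [← cf_symm e he N j]
    exact mono_of_strict h (by linarith) (by linarith) (by linarith)

lemma qp_one {e : ℕ} (he : 1 ≤ e) : QP e 1 := by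
  intro i j h1 h2 h3 h4
  simp only [Nat.cast_one, one_mul] at h2 h4
  rw [cf_neg e 1 i (by omega)]
  rw [cf]
  refine Finset.sum_pos' (fun l _ => ?_) ⟨j.toNat, Finset.mem_range.2 (by omega), ?_⟩
  · simp only [cf]; split_ifs <;> simp
  · simp only [cf]; rw [if_pos (by omega)]; exact one_pos

lemma strict_succ {e N : ℕ} (he : 1 ≤ e) (hN : 1 ≤ N) (h : QP e N) : StrictP e (N + 1) := by
  intro k hk hk2
  have hd := cf_diff e N k
  have he' : (1 : ℤ) ≤ e := by exact_mod_cast he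
  have hN' : (1 : ℤ) ≤ N := by exact_mod_cast hN
  have h5 : (e - 1 : ℤ) ≤ N * (e - 1) := by nlinarith
  push_cast at hk2
  have := h (k - e) k (by omega) (by linarith) hk (by linarith)
  linarith

lemma strict_all {e : ℕ} (he : 1 ≤ e) (N : ℕ) : StrictP e (N + 2) := by
  induction N with
  | zero => exact strict_succ he le_rfl (qp_one he)
  | succ N ih => exact strict_succ he (by omega) (qp_of_strict he ih)

lemma sop_of_zero {N : ℕ} {f : Fin N → Sg N}
    (h : ∀ x : Fin N → ℂ, (∀ i, eval x (f i) = 0) → x = 0) : Sop f := by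
  intro i
  have : (X i : Sg N) ∈ (idl f Finset.univ).radical := by
    rw [← vanishingIdeal_zeroLocus_eq_radical (K := ℂ), mem_vanishingIdeal_iff]
    intro x hx
    rw [idl_univ, zeroLocus_span] at hx
    have hx0 : x = 0 := h x fun j => by
      have := hx (f j) ⟨j, rfl⟩
      rwa [aeval_eq_eval] at this
    simp [hx0]
  exact this

end JacHilb

/-- The Hilbert function of the Jacobian ring of a smooth hypersurface of degree `d ≥ 3` in
`ℙ^{n+1}` is strictly increasing up to the middle degree `σ/2`, where `σ = (n+2)(d-2)`. -/
theorem jacobian_ring_hilbert_function_strictly_increasing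
    (n d : ℕ) (hn : 1 ≤ n) (hd : 3 ≤ d)
    (F : MvPolynomial (Fin (n + 2)) ℂ) (hF : F.IsHomogeneous d)
    (hsmooth : ∀ x : Fin (n + 2) → ℂ, (∀ i, eval x (pderiv i F) = 0) → x = 0) :
    ∀ j k : ℕ, j < k → 2 * k ≤ (n + 2) * (d - 2) →
      Module.finrank ℂ (gradedPiece (jacobianIdeal F) j)
        < Module.finrank ℂ (gradedPiece (jacobianIdeal F) k) := by
  intro j k hjk hk
  have hf : ∀ i, (pderiv i F).IsHomogeneous (d - 1) := fun i => hF.pderiv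
  have he : 1 ≤ d - 1 := by omega
  have hH := JacHilb.Hs_sop he hf (JacHilb.sop_of_zero hsmooth)
  rw [JacHilb.idl_univ] at hH
  have hc : ∀ l : ℕ, (Module.finrank ℂ (gradedPiece (jacobianIdeal F) l) : ℤ) =
      JacHilb.cf (d - 1) (n + 2) l := by
    intro l
    rw [← JacHilb.cf_coeff, ← hH, JacHilb.Hs, PowerSeries.coeff_mk]
    rfl
  have h1 := JacHilb.mono_of_strict (JacHilb.strict_all he n) (i := j) (j := k)
    (by exact_mod_cast hjk) (by positivity) (by
      have h2 : (((d - 1 : ℕ) : ℤ) - 1) = ((d - 2 : ℕ) : ℤ) := by omega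
      rw [h2]; exact_mod_cast hk)
  rw [← hc, ← hc] at h1
  exact_mod_cast h1
end
end

section
/- Let n ≥ 1 and d ≥ n+2, and let F be a homogeneous polynomial of degree d in S = ℂ[x_0,…,x_{n+1}] such that the only common zero of the partial derivatives ∂F/∂x_0,…,∂F/∂x_{n+1} in ℂ^{n+2} is the origin. Then dim_ℂ R(F)_{d−(n+2)} = dim_ℂ R(F)_{(n+1)d−(n+2)}. -/
noncomputable section

open MvPolynomial

section Helpers

attribute [local instance] MvPolynomial.gradedAlgebra

theorem hx_hc_mul {N : ℕ} {f b : MvPolynomial (Fin N) ℂ} {e : ℕ} (hf : f.IsHomogeneous e) (k : ℕ) :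
    homogeneousComponent (e + k) (f * b) = f * homogeneousComponent k b := by
  have := DirectSum.coe_decompose_mul_add_of_left_mem (homogeneousSubmodule (Fin N) ℂ)
    (a := f) (b := b) (i := e) (j := k) hf
  simp only [← MvPolynomial.decomposition.decompose'_apply]
  exact this

theorem hx_hc_mul_lt {N : ℕ} {f b : MvPolynomial (Fin N) ℂ} {e k : ℕ} (hf : f.IsHomogeneous e)
    (hk : k < e) : homogeneousComponent k (f * b) = 0 := by
  have := DirectSum.coe_decompose_mul_of_left_mem_of_not_le (homogeneousSubmodule (Fin N) ℂ)
    (a := f) (b := b) (i := e) (n := k) hf (by omega)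
  simp only [← MvPolynomial.decomposition.decompose'_apply]
  exact this

def HXHom {N : ℕ} (I : Ideal (MvPolynomial (Fin N) ℂ)) : Prop :=
  ∀ p ∈ I, ∀ k, homogeneousComponent k p ∈ I

theorem HXHom.mem {N : ℕ} {I : Ideal (MvPolynomial (Fin N) ℂ)} {p : MvPolynomial (Fin N) ℂ}
    (h : ∀ k, homogeneousComponent k p ∈ I) : p ∈ I := by
  rw [← sum_homogeneousComponent p]
  exact Ideal.sum_mem _ fun i _ => h i

theorem HXHom.bot {N : ℕ} : HXHom (⊥ : Ideal (MvPolynomial (Fin N) ℂ)) := by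
  intro p hp k
  rw [Ideal.mem_bot] at hp
  simp [hp]

theorem HXHom.sup {N : ℕ} {I : Ideal (MvPolynomial (Fin N) ℂ)} (hI : HXHom I)
    {f : MvPolynomial (Fin N) ℂ} {e : ℕ} (hf : f.IsHomogeneous e) : HXHom (I ⊔ Ideal.span {f}) := by
  intro p hp k
  obtain ⟨i, hi, g, hg, rfl⟩ := Submodule.mem_sup.1 hp
  obtain ⟨b, rfl⟩ := Ideal.mem_span_singleton'.1 hg
  rw [map_add]
  refine Ideal.add_mem _ (Ideal.mem_sup_left (hI i hi k)) (Ideal.mem_sup_right ?_)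
  rw [mul_comm]
  by_cases h : k < e
  · rw [hx_hc_mul_lt hf h]; exact zero_mem _
  · obtain ⟨j, rfl⟩ := Nat.exists_eq_add_of_le (not_lt.1 h)
    rw [hx_hc_mul hf]
    exact Ideal.mul_mem_right _ _ (Ideal.mem_span_singleton_self f)

def HXNzd {R : Type*} [CommRing R] (f : R) (I : Ideal R) : Prop := ∀ a, f * a ∈ I → a ∈ I

def HXReg {R : Type*} [CommRing R] : Ideal R → List R → Prop
  | _, [] => True
  | I, f :: fs => HXNzd f I ∧ HXReg (I ⊔ Ideal.span {f}) fs

/-- `I` plus the ideal generated by the members of the list. -/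
def hxSpan {R : Type*} [CommRing R] : Ideal R → List R → Ideal R
  | I, [] => I
  | I, f :: fs => hxSpan (I ⊔ Ideal.span {f}) fs

theorem hxSpan_eq {R : Type*} [CommRing R] (fs : List R) (I : Ideal R) :
    hxSpan I fs = I ⊔ Ideal.span {f | f ∈ fs} := by
  induction fs generalizing I with
  | nil => simp [hxSpan]
  | cons f fs ih =>
    rw [hxSpan, ih, sup_assoc, ← Ideal.span_union]
    congr 2
    ext; simp

theorem hxReg_append {R : Type*} [CommRing R] (fs : List R) (f : R) (I : Ideal R) :
    HXReg I (fs ++ [f]) ↔ HXReg I fs ∧ HXNzd f (hxSpan I fs) := by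
  induction fs generalizing I with
  | nil => simp [HXReg, hxSpan]
  | cons g fs ih => simp [HXReg, hxSpan, ih, and_assoc]

theorem hxNzd_pow {R : Type*} [CommRing R] {f : R} {I : Ideal R} (h : HXNzd f I) (n : ℕ) :
    HXNzd (f ^ n) I := by
  induction n with
  | zero => intro a; simp
  | succ n ih =>
    intro a ha
    refine h a (ih _ ?_)
    rwa [pow_succ, mul_assoc] at ha

/-- exchange -/
theorem hxNzd_exchange {R : Type*} [CommRing R] {f l : R} {I : Ideal R} (h : HXNzd l I)
    (hl : l ∈ (I ⊔ Ideal.span {f}).radical) : HXNzd f I := by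
  obtain ⟨n, hn⟩ := hl
  obtain ⟨i, hi, g, hg, e⟩ := Submodule.mem_sup.1 hn
  obtain ⟨b, rfl⟩ := Ideal.mem_span_singleton'.1 hg
  intro a ha
  refine hxNzd_pow h n a ?_
  rw [← e, add_mul, mul_assoc]
  exact I.add_mem (I.mul_mem_right _ hi) (I.mul_mem_left _ ha)

theorem hx_nak {N : ℕ} {I : Ideal (MvPolynomial (Fin N) ℂ)} (hI : HXHom I)
    {f l : MvPolynomial (Fin N) ℂ} (hl : l.IsHomogeneous 1)
    (h1 : HXNzd l I) (h2 : HXNzd f (I ⊔ Ideal.span {l})) : HXNzd f I := by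
  have key : ∀ n, ∀ a, f * a ∈ I → ∃ b, f * b ∈ I ∧ a - l ^ n * b ∈ I := by
    intro n
    induction n with
    | zero => intro a ha; exact ⟨a, ha, by simp⟩
    | succ n ih =>
      intro a ha
      obtain ⟨b, hb, hab⟩ := ih a ha
      obtain ⟨i, hi, g, hg, e⟩ := Submodule.mem_sup.1 (h2 b (Ideal.mem_sup_left hb))
      obtain ⟨c, rfl⟩ := Ideal.mem_span_singleton'.1 hg
      refine ⟨c, h1 _ ?_, ?_⟩
      · have : l * (f * c) = f * b - f * i := by rw [← e]; ring
        rw [this]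
        exact I.sub_mem hb (I.mul_mem_left _ hi)
      · have : a - l ^ (n + 1) * c = (a - l ^ n * b) + l ^ n * i := by rw [← e]; ring
        rw [this]
        exact I.add_mem hab (I.mul_mem_left _ hi)
  intro a ha
  refine HXHom.mem fun k => ?_
  obtain ⟨b, -, hab⟩ := key (k + 1) a ha
  have := hI _ hab k
  have hl' : (l ^ (k + 1)).IsHomogeneous (k + 1) := by simpa using hl.pow (k + 1)
  rwa [map_sub, hx_hc_mul_lt hl' (Nat.lt_succ_self k), sub_zero] at this

theorem hx_swap {N : ℕ} {l : MvPolynomial (Fin N) ℂ} (hl : l.IsHomogeneous 1) {e : ℕ}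
    (fs : List (MvPolynomial (Fin N) ℂ)) (hfs : ∀ f ∈ fs, f.IsHomogeneous e)
    (I : Ideal (MvPolynomial (Fin N) ℂ)) (hI : HXHom I) (h1 : HXNzd l I)
    (h2 : HXReg (I ⊔ Ideal.span {l}) fs) : HXReg I fs ∧ HXNzd l (hxSpan I fs) := by
  induction fs generalizing I with
  | nil => exact ⟨trivial, h1⟩
  | cons f fs ih =>
    have hf := hfs f (by simp)
    obtain ⟨h2a, h2b⟩ := h2
    have h3 := hx_nak hI hl h1 h2a
    have h4 : HXNzd l (I ⊔ Ideal.span {f}) := by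
      intro m hm
      obtain ⟨i, hi, g, hg, e⟩ := Submodule.mem_sup.1 hm
      obtain ⟨c, rfl⟩ := Ideal.mem_span_singleton'.1 hg
      have : f * c ∈ I ⊔ Ideal.span {l} := by
        have : f * c = l * m - i := by rw [← e]; ring
        rw [this]
        exact Ideal.sub_mem _ (Ideal.mem_sup_right (Ideal.mul_mem_right _ _
          (Ideal.mem_span_singleton_self l))) (Ideal.mem_sup_left hi)
      obtain ⟨j, hj, g, hg, e'⟩ := Submodule.mem_sup.1 (h2a c this)
      obtain ⟨c', rfl⟩ := Ideal.mem_span_singleton'.1 hg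
      have h5 : m - f * c' ∈ I := by
        apply h1
        have : l * (m - f * c') = i + f * j := by
          rw [mul_sub, ← e, ← e']; ring
        rw [this]
        exact I.add_mem hi (I.mul_mem_left _ hj)
      have : m = (m - f * c') + f * c' := by ring
      rw [this]
      exact Ideal.add_mem _ (Ideal.mem_sup_left h5) (Ideal.mem_sup_right (Ideal.mul_mem_right _ _
          (Ideal.mem_span_singleton_self f)))
    have := ih (fun g hg => hfs g (by simp [hg])) _ (hI.sup hf) h4 (by
      rwa [sup_right_comm])
    exact ⟨⟨h3, this.1⟩, this.2⟩

theorem hxReg_comap {R T : Type*} [CommRing R] [CommRing T] (φ : R →+* T)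
    (hφ : Function.Surjective φ) (fs : List R) (I : Ideal T) (h : HXReg I (fs.map φ)) :
    HXReg (I.comap φ) fs := by
  induction fs generalizing I with
  | nil => trivial
  | cons f fs ih =>
    obtain ⟨ha, hb⟩ := h
    refine ⟨fun a haa => ?_, ?_⟩
    · rw [Ideal.mem_comap, map_mul] at haa
      exact ha _ haa
    · have := ih _ hb
      convert this using 1
      apply le_antisymm
      · refine sup_le (Ideal.comap_mono le_sup_left) ?_
        rw [Ideal.span_singleton_le_iff_mem, Ideal.mem_comap]
        exact Ideal.mem_sup_right (Ideal.mem_span_singleton_self _)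
      · intro x hx
        rw [Ideal.mem_comap] at hx
        obtain ⟨i, hi, g, hg, e⟩ := Submodule.mem_sup.1 hx
        obtain ⟨c, rfl⟩ := Ideal.mem_span_singleton'.1 hg
        obtain ⟨c, rfl⟩ := hφ c
        have : x = (x - c * f) + c * f := by ring
        rw [this]
        refine Ideal.add_mem _ (Ideal.mem_sup_left ?_) (Ideal.mem_sup_right
          (Ideal.mul_mem_left _ _ (Ideal.mem_span_singleton_self f)))
        rw [Ideal.mem_comap, map_sub, map_mul, ← e]
        simpa using hi

theorem hx_height {N : ℕ} : (N : ℕ∞) ≤ (RingHom.ker (eval (0 : Fin N → ℂ))).height := by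
  let φ : ℕ → MvPolynomial (Fin N) ℂ →ₐ[ℂ] MvPolynomial (Fin N) ℂ :=
    fun i => aeval (fun j => if (j : ℕ) < i then 0 else X j)
  have hcomp : ∀ i p, φ (i + 1) (φ i p) = φ (i + 1) p := by
    intro i p
    have : (φ (i + 1)).comp (φ i) = φ (i + 1) := by
      apply MvPolynomial.algHom_ext
      intro j
      simp only [φ, AlgHom.comp_apply, aeval_X]
      split_ifs <;> first | omega | simp_all
    exact DFunLike.congr_fun this p
  have hprime : ∀ i, (RingHom.ker (φ i)).IsPrime := fun i => RingHom.ker_isPrime _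
  have hle : ∀ i, i ≤ N → (i : ℕ∞) ≤ (RingHom.ker (φ i)).height := by
    intro i
    induction i with
    | zero => simp
    | succ i ih =>
      intro hi
      have hlt : RingHom.ker (φ i) < RingHom.ker (φ (i + 1)) := by
        rw [lt_iff_le_not_ge]
        constructor
        · intro p hp
          rw [RingHom.mem_ker] at hp ⊢
          rw [← hcomp, hp, map_zero]
        · intro h
          have h1 : X (⟨i, by omega⟩ : Fin N) ∈ RingHom.ker (φ (i + 1)) := by
            simp [RingHom.mem_ker, φ]
          have := h h1
          simp [RingHom.mem_ker, φ] at this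
      have h1 := ih (by omega)
      have : (RingHom.ker (φ i)).height < (RingHom.ker (φ (i+1))).height :=
        Ideal.height_strict_mono_of_isPrime_of_isPrime hlt
      push_cast
      exact (add_le_add_left h1 1).trans (Order.add_one_le_of_lt this)
  refine (hle N le_rfl).trans (Ideal.height_mono ?_)
  intro p hp
  rw [RingHom.mem_ker] at hp ⊢
  have : (eval (0 : Fin N → ℂ)).comp (φ N : MvPolynomial (Fin N) ℂ →+* MvPolynomial (Fin N) ℂ) = eval 0 := by
    apply MvPolynomial.ringHom_ext
    · intro r; simp [φ]
    · intro j; simp [φ]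
  rw [← this]
  simp [hp]

theorem hx_eval_smul {N : ℕ} {g : MvPolynomial (Fin N) ℂ} {e : ℕ} (hg : g.IsHomogeneous e)
    (x : Fin N → ℂ) (t : ℂ) : eval (t • x) g = t ^ e * eval x g := by
  rw [eval_eq', eval_eq', Finset.mul_sum]
  refine Finset.sum_congr rfl fun d hd => ?_
  have h1 : ∑ i, d i = e := by
    rw [← hg (mem_support_iff.1 hd), ← Finsupp.degree_eq_sum, Finsupp.degree_eq_weight_one]
    rfl
  simp only [Pi.smul_apply, smul_eq_mul, mul_pow, Finset.prod_mul_distrib]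
  rw [Finset.prod_pow_eq_pow_sum, h1]
  ring

theorem hx_ker_eval_le {N : ℕ} {P : Ideal (MvPolynomial (Fin N) ℂ)} (h : ∀ i, X i ∈ P) :
    RingHom.ker (eval (0 : Fin N → ℂ)) ≤ P := by
  intro p hp
  have h1 : ∀ q : MvPolynomial (Fin N) ℂ, q - C (eval 0 q) ∈ P := by
    intro q
    rw [← Ideal.Quotient.eq_zero_iff_mem, map_sub, sub_eq_zero]
    have : (Ideal.Quotient.mk P) = (Ideal.Quotient.mk P).comp (C.comp (eval 0)) := by
      apply MvPolynomial.ringHom_ext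
      · intro r; simp
      · intro j; simpa using Ideal.Quotient.eq_zero_iff_mem.2 (h j)
    exact DFunLike.congr_fun this q
  have := h1 p
  rw [RingHom.mem_ker] at hp
  rwa [hp, C_0, sub_zero] at this

theorem hx_eval_line {N : ℕ} {g : MvPolynomial (Fin N) ℂ} {e : ℕ} (hg : g.IsHomogeneous e)
    (x : Fin N → ℂ) (hx : eval x g = 0) :
    aeval (fun i => Polynomial.C (x i) * Polynomial.X) g = (0 : Polynomial ℂ) := by
  apply Polynomial.funext
  intro t
  have h1 : (Polynomial.evalRingHom t).comp
      (aeval (fun i => Polynomial.C (x i) * Polynomial.X) :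
        MvPolynomial (Fin N) ℂ →ₐ[ℂ] Polynomial ℂ).toRingHom = eval (t • x) := by
    apply MvPolynomial.ringHom_ext
    · intro r; simp
    · intro j; simp [mul_comm (x j)]
  have h2 := DFunLike.congr_fun h1 g
  have h3 : eval (t • x) g = t ^ e * eval x g := hx_eval_smul hg x t
  rw [hx, mul_zero] at h3
  rw [h3] at h2
  simpa using h2

theorem hx_exists_linear {N e : ℕ} (gs : List (MvPolynomial (Fin (N + 1)) ℂ)) (hlen : gs.length = N)
    (hgs : ∀ g ∈ gs, g.IsHomogeneous e) (f : MvPolynomial (Fin (N + 1)) ℂ) (hf : eval 0 f = 0)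
    (hz : ∀ x, (∀ g ∈ gs, eval x g = 0) → eval x f = 0 → x = 0) :
    ∃ c : Fin (N + 1) → ℂ, c ≠ 0 ∧
      ∀ x, (∀ g ∈ gs, eval x g = 0) → ∑ i, c i * x i = 0 → x = 0 := by
  classical
  let I : Ideal (MvPolynomial (Fin (N + 1)) ℂ) := Ideal.span {g | g ∈ gs}
  let m : Ideal (MvPolynomial (Fin (N + 1)) ℂ) := RingHom.ker (eval (0 : Fin (N + 1) → ℂ))
  have hfin : I.minimalPrimes.Finite := Ideal.finite_minimalPrimes_of_isNoetherianRing _ I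
  let L : (Fin (N + 1) → ℂ) →ₗ[ℂ] MvPolynomial (Fin (N + 1)) ℂ := Fintype.linearCombination ℂ (fun i => (X i : MvPolynomial (Fin (N + 1)) ℂ))
  have hL : ∀ c, L c = ∑ i, C (c i) * X i := by
    intro c; simp [L, Fintype.linearCombination_apply, smul_eq_C_mul]
  let V : Ideal (MvPolynomial (Fin (N + 1)) ℂ) → Submodule ℂ (Fin (N + 1) → ℂ) := fun P => (P.restrictScalars ℂ).comap L
  let s : Finset (Submodule ℂ (Fin (N + 1) → ℂ)) := insert ⊥ (hfin.toFinset.image V)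
  have hs : ⊤ ∉ s := by
    intro h
    simp only [s, Finset.mem_insert, Finset.mem_image, Set.Finite.mem_toFinset] at h
    rcases h with h | ⟨P, hP, hPV⟩
    · exact top_ne_bot h
    · have h1 : ∀ i, (X i : MvPolynomial (Fin (N + 1)) ℂ) ∈ P := by
        intro i
        have : (Pi.single i 1 : Fin (N + 1) → ℂ) ∈ V P := by rw [hPV]; trivial
        simpa [V, L] using this
      have h2 := (hx_height (N := N + 1)).trans (Ideal.height_mono (hx_ker_eval_le h1))
      have h3 : P.height ≤ (N : ℕ∞) := by
        have : {g | g ∈ gs} = (gs.toFinset : Set (MvPolynomial (Fin (N + 1)) ℂ)) := by ext; simp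
        have h4 := Ideal.height_le_card_of_mem_minimalPrimes_span_finset
          (s := gs.toFinset) (by rw [← this]; exact hP)
        exact h4.trans (by exact_mod_cast hlen ▸ List.toFinset_card_le gs)
      have := h2.trans h3
      norm_cast at this
      omega
  have hne := Subspace.biUnion_ne_univ_of_top_notMem hs
  obtain ⟨c, hc⟩ := (Set.ne_univ_iff_exists_notMem _).1 hne
  simp only [s, Set.mem_iUnion, not_exists, Finset.mem_insert, Finset.mem_image,
    Set.Finite.mem_toFinset] at hc
  refine ⟨c, fun h => hc ⊥ (Or.inl rfl) (by simp [h]), ?_⟩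
  have hcP : ∀ P ∈ I.minimalPrimes, L c ∉ P := fun P hP h => hc (V P) (Or.inr ⟨P, hP, rfl⟩) h
  intro x hx hlx
  by_contra hx0
  let ψ : MvPolynomial (Fin (N + 1)) ℂ →ₐ[ℂ] Polynomial ℂ := aeval (fun i => Polynomial.C (x i) * Polynomial.X)
  let Q : Ideal (MvPolynomial (Fin (N + 1)) ℂ) := RingHom.ker ψ
  have hQp : Q.IsPrime := RingHom.ker_isPrime _
  have hmp : m.IsPrime := RingHom.ker_isPrime _
  have hIQ : I ≤ Q := by
    rw [Ideal.span_le]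
    intro g hg
    exact hx_eval_line (hgs g hg) x (hx g hg)
  have hLQ : L c ∈ Q := by
    rw [RingHom.mem_ker, hL]
    have : ψ (∑ i, C (c i) * X i) = Polynomial.C (∑ i, c i * x i) * Polynomial.X := by
      simp [ψ, map_sum, Finset.sum_mul, mul_assoc]
    rw [this, hlx]; simp
  have hQm : Q ≤ m := by
    intro p hp
    have h1 : (Polynomial.evalRingHom 0).comp ψ.toRingHom = eval (0 : Fin (N + 1) → ℂ) := by
      apply MvPolynomial.ringHom_ext
      · intro r; simp [ψ]
      · intro j; simp [ψ]
    rw [RingHom.mem_ker] at hp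
    show eval 0 p = 0
    rw [← h1]
    simp [hp]
  have hQm' : Q ≠ m := by
    intro h
    apply hx0
    funext i
    have : X i ∈ m := by simp [m, RingHom.mem_ker]
    rw [← h, RingHom.mem_ker] at this
    simpa [ψ] using this
  obtain ⟨P, hP, hPQ⟩ := Ideal.exists_minimalPrimes_le hIQ
  have hPp : P.IsPrime := hP.1.1
  have hPQ' : P ≠ Q := by
    intro h
    exact hcP P hP (h ▸ hLQ)
  have hmin : m ∈ (P ⊔ Ideal.span {f}).minimalPrimes := by
    refine ⟨⟨hmp, sup_le (hPQ.trans hQm) ?_⟩, ?_⟩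
    · rw [Ideal.span_singleton_le_iff_mem]; exact hf
    · rintro Q' ⟨hQ', hle⟩ -
      have h1 := IsPrime.vanishingIdeal_zeroLocus (k := ℂ) (K := ℂ) Q'
      intro p hp
      rw [← h1, mem_vanishingIdeal_iff]
      intro y hy
      have hy0 : y = 0 := by
        apply hz
        · intro g hg
          exact hy g (hle (Ideal.mem_sup_left (hP.1.2 (Ideal.subset_span hg))))
        · exact hy f (hle (Ideal.mem_sup_right (Ideal.mem_span_singleton_self f)))
      rw [hy0]
      exact hp
  have hht := Ideal.map_height_le_one_of_mem_minimalPrimes hmin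
  have hsurj : Function.Surjective (Ideal.Quotient.mk P) := Ideal.Quotient.mk_surjective
  have hk : RingHom.ker (Ideal.Quotient.mk P) = P := Ideal.mk_ker
  have i1 : (Q.map (Ideal.Quotient.mk P)).IsPrime :=
    Ideal.map_isPrime_of_surjective hsurj (hk.le.trans hPQ)
  have i2 : (m.map (Ideal.Quotient.mk P)).IsPrime :=
    Ideal.map_isPrime_of_surjective hsurj (hk.le.trans (hPQ.trans hQm))
  have hcm : ∀ A : Ideal (MvPolynomial (Fin (N + 1)) ℂ), P ≤ A → (A.map (Ideal.Quotient.mk P)).comap (Ideal.Quotient.mk P) = A := by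
    intro A hA
    rw [Ideal.comap_map_of_surjective _ hsurj, ← RingHom.ker_eq_comap_bot, hk, sup_eq_left.2 hA]
  have l1 : (⊥ : Ideal (MvPolynomial (Fin (N + 1)) ℂ ⧸ P)) < Q.map (Ideal.Quotient.mk P) := by
    refine lt_of_le_of_ne bot_le fun h => hPQ' ?_
    rw [← hcm Q hPQ, ← h, ← RingHom.ker_eq_comap_bot, hk]
  have l2 : Q.map (Ideal.Quotient.mk P) < m.map (Ideal.Quotient.mk P) := by
    refine lt_of_le_of_ne (Ideal.map_mono hQm) fun h => hQm' ?_
    rw [← hcm Q hPQ, h, hcm m (hPQ.trans hQm)]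
  have l1' := Ideal.height_strict_mono_of_isPrime_of_isPrime l1
  have l2' := Ideal.height_strict_mono_of_isPrime_of_isPrime l2
  have l3 := l2'.trans_le hht
  rw [Order.lt_one_iff] at l3
  rw [l3] at l1'
  exact absurd l1' (by simp)

theorem hx_reg (e : ℕ) (he : e ≠ 0) (N : ℕ) : ∀ (fs : List (MvPolynomial (Fin N) ℂ)),
    fs.length = N → (∀ f ∈ fs, f.IsHomogeneous e) →
    (∀ x, (∀ f ∈ fs, eval x f = 0) → x = 0) → HXReg ⊥ fs := by
  induction N with
  | zero =>
    intro fs hlen _ _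
    rw [List.length_eq_zero_iff.1 hlen]; trivial
  | succ N ih =>
    intro fs hlen hfs hz
    rcases List.eq_nil_or_concat fs with rfl | ⟨gs, f, rfl⟩
    · simp at hlen
    rw [List.concat_eq_append] at *
    have hlen' : gs.length = N := by simpa using hlen
    have hgs : ∀ g ∈ gs, g.IsHomogeneous e := fun g hg => hfs g (by simp [hg])
    have hf : f.IsHomogeneous e := hfs f (by simp)
    have hz' : ∀ x, (∀ g ∈ gs, eval x g = 0) → eval x f = 0 → x = 0 := by
      intro x h1 h2
      apply hz
      intro g hg
      rcases List.mem_append.1 hg with h | h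
      · exact h1 g h
      · rw [List.mem_singleton.1 h]; exact h2
    have hf0 : eval 0 f = 0 := by
      have := hx_eval_smul hf 0 0
      rwa [zero_pow he, zero_mul, smul_zero] at this
    obtain ⟨c, hc0, hc⟩ := hx_exists_linear gs hlen' hgs f hf0 hz'
    obtain ⟨j, hj⟩ := Function.ne_iff.1 hc0
    have hj : c j ≠ 0 := hj
    let l : MvPolynomial (Fin (N + 1)) ℂ := ∑ i, C (c i) * X i
    have hl1 : l.IsHomogeneous 1 := by
      apply IsHomogeneous.sum
      intro i _
      simpa using (isHomogeneous_C _ (c i)).mul (isHomogeneous_X ℂ i)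
    have hlev : ∀ x, eval x l = ∑ i, c i * x i := by intro x; simp [l]
    have hl0 : l ≠ 0 := by
      intro h
      have := hlev (Pi.single j 1)
      rw [h] at this
      simp [Pi.single_apply] at this
      exact hj this.symm
    let A : MvPolynomial (Fin N) ℂ := - ∑ i, C (c (j.succAbove i) / c j) * X i
    let φ : MvPolynomial (Fin (N + 1)) ℂ →ₐ[ℂ] MvPolynomial (Fin N) ℂ :=
      aeval (Fin.insertNth (α := fun _ => MvPolynomial (Fin N) ℂ) j A X)
    have hφj : φ (X j) = A := by simp [φ]
    have hφs : ∀ i, φ (X (j.succAbove i)) = X i := by intro i; simp [φ]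
    let ι : MvPolynomial (Fin N) ℂ →ₐ[ℂ] MvPolynomial (Fin (N + 1)) ℂ := rename j.succAbove
    have hφι : ∀ p, φ (ι p) = p := by
      intro p
      have : φ.comp ι = AlgHom.id ℂ _ := by
        apply MvPolynomial.algHom_ext
        intro i
        simp only [AlgHom.comp_apply, ι, rename_X, hφs, AlgHom.id_apply]
      exact DFunLike.congr_fun this p
    have hsurj : Function.Surjective φ := fun p => ⟨ι p, hφι p⟩
    have hφC : ∀ r, φ (C r) = C r := fun r => φ.commutes r
    have hlA : l = C (c j) * (X j - ι A) := by
      simp only [l, A, Fin.sum_univ_succAbove _ j, map_neg, map_sum, map_mul, sub_neg_eq_add,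
        mul_add, Finset.mul_sum, ι, rename_X, rename_C]
      congr 1
      refine Finset.sum_congr rfl fun i _ => ?_
      rw [← mul_assoc, ← C_mul, mul_div_cancel₀ _ hj]
    have hφl : φ l = 0 := by
      rw [hlA, map_mul, map_sub, hφι, hφj, sub_self, mul_zero]
    have hXA : X j - ι A ∈ Ideal.span {l} := by
      have : X j - ι A = C ((c j)⁻¹) * l := by
        rw [hlA, ← mul_assoc, ← C_mul, inv_mul_cancel₀ hj, C_1, one_mul]
      rw [this]
      exact Ideal.mul_mem_left _ _ (Ideal.mem_span_singleton_self l)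
    have hker : Ideal.comap (φ : MvPolynomial (Fin (N + 1)) ℂ →+* MvPolynomial (Fin N) ℂ) ⊥
        = ⊥ ⊔ Ideal.span {l} := by
      rw [bot_sup_eq]
      apply le_antisymm
      · intro p hp
        have hp' : φ p = 0 := hp
        have h1 : (Ideal.Quotient.mkₐ ℂ (Ideal.span {l})).comp (ι.comp φ)
            = Ideal.Quotient.mkₐ ℂ (Ideal.span {l}) := by
          apply MvPolynomial.algHom_ext
          intro k
          rcases Fin.eq_self_or_eq_succAbove j k with rfl | ⟨i, rfl⟩
          · simp only [AlgHom.comp_apply, hφj, Ideal.Quotient.mkₐ_eq_mk]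
            symm
            rw [Ideal.Quotient.eq]
            exact hXA
          · simp only [AlgHom.comp_apply, hφs, ι, rename_X]
        have h2 := DFunLike.congr_fun h1 p
        simp only [AlgHom.comp_apply, hp', map_zero, Ideal.Quotient.mkₐ_eq_mk] at h2
        exact Ideal.Quotient.eq_zero_iff_mem.1 h2.symm
      · rw [Ideal.span_singleton_le_iff_mem]
        exact hφl
    have hφhom : ∀ g : MvPolynomial (Fin (N + 1)) ℂ, g.IsHomogeneous e → (φ g).IsHomogeneous e := by
      intro g hg
      have := hg.aeval (n := 1) (Fin.insertNth (α := fun _ => MvPolynomial (Fin N) ℂ) j A X) (by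
        intro k
        rcases Fin.eq_self_or_eq_succAbove j k with rfl | ⟨i, rfl⟩
        · simp only [Fin.insertNth_apply_same, A]
          apply IsHomogeneous.neg
          apply IsHomogeneous.sum
          intro i _
          simpa using (isHomogeneous_C _ _).mul (isHomogeneous_X ℂ i)
        · simp only [Fin.insertNth_apply_succAbove]
          exact isHomogeneous_X ℂ i)
      rwa [one_mul] at this
    have hreg1 : HXReg (⊥ : Ideal (MvPolynomial (Fin N) ℂ))
        (gs.map (φ : MvPolynomial (Fin (N + 1)) ℂ →+* MvPolynomial (Fin N) ℂ)) := by
      apply ih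
      · simpa using hlen'
      · intro f hf
        obtain ⟨g, hg, rfl⟩ := List.mem_map.1 hf
        exact hφhom g (hgs g hg)
      · intro x hx
        let y : Fin (N + 1) → ℂ := fun k => eval x (φ (X k))
        have hy : ∀ p, eval y p = eval x (φ p) := by
          intro p
          have : eval y = (eval x).comp (φ : MvPolynomial (Fin (N + 1)) ℂ →+* MvPolynomial (Fin N) ℂ) := by
            apply MvPolynomial.ringHom_ext
            · intro r
              simp [hφC]
            · intro k; simp [y]
          exact DFunLike.congr_fun this p
        have hy0 : y = 0 := by
          apply hc
          · intro g hg
            rw [hy]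
            exact hx _ (List.mem_map.2 ⟨g, hg, rfl⟩)
          · rw [← hlev, hy, hφl, map_zero]
        funext i
        have := congrFun hy0 (j.succAbove i)
        simpa [y, hφs] using this
    have hreg2 := hxReg_comap (φ : MvPolynomial (Fin (N + 1)) ℂ →+* MvPolynomial (Fin N) ℂ) hsurj gs ⊥ hreg1
    rw [hker] at hreg2
    have hnz : HXNzd l (⊥ : Ideal (MvPolynomial (Fin (N + 1)) ℂ)) := by
      intro a ha
      rw [Ideal.mem_bot] at ha ⊢
      exact (mul_eq_zero.1 ha).resolve_left hl0
    obtain ⟨h1, h2⟩ := hx_swap hl1 gs hgs ⊥ HXHom.bot hnz hreg2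
    rw [hxReg_append]
    refine ⟨h1, hxNzd_exchange h2 ?_⟩
    rw [← vanishingIdeal_zeroLocus_eq_radical (K := ℂ), mem_vanishingIdeal_iff]
    intro y hy
    have hy0 : y = 0 := by
      apply hz'
      · intro g hg
        refine hy g (Ideal.mem_sup_left ?_)
        rw [hxSpan_eq]
        exact Ideal.mem_sup_right (Ideal.subset_span hg)
      · exact hy f (Ideal.mem_sup_right (Ideal.mem_span_singleton_self f))
    rw [hy0]
    have := hlev 0
    simpa using this

theorem hx_mem_gp {N : ℕ} {I : Ideal (MvPolynomial (Fin N) ℂ)} {k : ℕ}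
    {z : MvPolynomial (Fin N) ℂ ⧸ I} :
    z ∈ gradedPiece I k ↔ ∃ p : MvPolynomial (Fin N) ℂ, p.IsHomogeneous k ∧
      Ideal.Quotient.mk I p = z := by
  simp [gradedPiece, Submodule.mem_map, mem_homogeneousSubmodule]

instance hx_fin {N : ℕ} (I : Ideal (MvPolynomial (Fin N) ℂ)) (k : ℕ) :
    Module.Finite ℂ (gradedPiece I k) :=
  Module.Finite.iff_fg.2 ((homogeneousSubmodule_fg (Fin N) ℂ k).map _)

theorem hx_rank_aux {N : ℕ} (I J : Ideal (MvPolynomial (Fin N) ℂ)) (hIJ : I ≤ J) (m : ℕ)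
    (W : Submodule ℂ (MvPolynomial (Fin N) ℂ ⧸ I))
    (hW : ∀ p : MvPolynomial (Fin N) ℂ, p.IsHomogeneous m → p ∈ J → Ideal.Quotient.mk I p ∈ W)
    (hW1 : W ≤ gradedPiece I m) (hW2 : ∀ w ∈ W, Ideal.Quotient.factor hIJ w = 0) :
    Module.finrank ℂ (gradedPiece I m) =
      Module.finrank ℂ (gradedPiece J m) + Module.finrank ℂ W := by
  let g := (Ideal.Quotient.factorₐ ℂ hIJ).toLinearMap
  have hg : ∀ p, g (Ideal.Quotient.mk I p) = Ideal.Quotient.mk J p := fun p => rfl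
  have h1 : (gradedPiece I m).map g = gradedPiece J m := by
    ext z
    rw [Submodule.mem_map, hx_mem_gp]
    constructor
    · rintro ⟨y, hy, rfl⟩
      obtain ⟨p, hp, rfl⟩ := hx_mem_gp.1 hy
      exact ⟨p, hp, (hg p).symm⟩
    · rintro ⟨p, hp, rfl⟩
      exact ⟨_, hx_mem_gp.2 ⟨p, hp, rfl⟩, hg p⟩
  have h2 := LinearMap.finrank_range_add_finrank_ker (g.domRestrict (gradedPiece I m))
  rw [LinearMap.range_domRestrict, h1] at h2
  rw [← h2]
  congr 1
  rw [← Submodule.finrank_map_subtype_eq]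
  have : (LinearMap.ker (g.domRestrict (gradedPiece I m))).map (gradedPiece I m).subtype = W := by
    ext z
    rw [Submodule.mem_map]
    constructor
    · rintro ⟨⟨y, hy⟩, hk, rfl⟩
      obtain ⟨p, hp, rfl⟩ := hx_mem_gp.1 hy
      have hk' : g (Ideal.Quotient.mk I p) = 0 := hk
      rw [hg, Ideal.Quotient.eq_zero_iff_mem] at hk'
      exact hW p hp hk'
    · intro hz
      exact ⟨⟨z, hW1 hz⟩, hW2 z hz, rfl⟩
  rw [this]

theorem hx_rank_lt {N : ℕ} {I : Ideal (MvPolynomial (Fin N) ℂ)} (hI : HXHom I)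
    {f : MvPolynomial (Fin N) ℂ} {e : ℕ} (hf : f.IsHomogeneous e) {k : ℕ} (hk : k < e) :
    Module.finrank ℂ (gradedPiece I k) =
      Module.finrank ℂ (gradedPiece (I ⊔ Ideal.span {f}) k) := by
  have := hx_rank_aux I (I ⊔ Ideal.span {f}) le_sup_left k ⊥ ?_ bot_le ?_
  · simpa using this
  · intro p hp hpJ
    obtain ⟨i, hi, g, hg, rfl⟩ := Submodule.mem_sup.1 hpJ
    obtain ⟨c, rfl⟩ := Ideal.mem_span_singleton'.1 hg
    rw [Submodule.mem_bot, Ideal.Quotient.eq_zero_iff_mem]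
    rw [← homogeneousComponent_eq_self hp, map_add, mul_comm, hx_hc_mul_lt hf hk, add_zero]
    exact hI i hi k
  · intro w hw
    rw [(Submodule.mem_bot ℂ).1 hw, map_zero]

theorem hx_rank_ge {N : ℕ} {I : Ideal (MvPolynomial (Fin N) ℂ)} (hI : HXHom I)
    {f : MvPolynomial (Fin N) ℂ} {e : ℕ} (hf : f.IsHomogeneous e) (hn : HXNzd f I) (k : ℕ) :
    Module.finrank ℂ (gradedPiece I (e + k)) =
      Module.finrank ℂ (gradedPiece (I ⊔ Ideal.span {f}) (e + k))
        + Module.finrank ℂ (gradedPiece I k) := by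
  have hinj : Function.Injective (mulMap I f) := by
    rw [← LinearMap.ker_eq_bot, LinearMap.ker_eq_bot']
    intro z hz
    obtain ⟨p, rfl⟩ := Ideal.Quotient.mk_surjective z
    have hz' : Ideal.Quotient.mk I f * Ideal.Quotient.mk I p = 0 := hz
    rw [← map_mul, Ideal.Quotient.eq_zero_iff_mem] at hz'
    exact Ideal.Quotient.eq_zero_iff_mem.2 (hn p hz')
  rw [LinearEquiv.finrank_eq (Submodule.equivMapOfInjective (mulMap I f) hinj (gradedPiece I k))]
  have hmem : ∀ z, z ∈ (gradedPiece I k).map (mulMap I f) ↔ ∃ p : MvPolynomial (Fin N) ℂ,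
      p.IsHomogeneous k ∧ Ideal.Quotient.mk I (f * p) = z := by
    intro z
    rw [Submodule.mem_map]
    constructor
    · rintro ⟨y, hy, rfl⟩
      obtain ⟨p, hp, rfl⟩ := hx_mem_gp.1 hy
      exact ⟨p, hp, map_mul _ _ _⟩
    · rintro ⟨p, hp, rfl⟩
      exact ⟨_, hx_mem_gp.2 ⟨p, hp, rfl⟩, (map_mul _ _ _).symm⟩
  refine hx_rank_aux I (I ⊔ Ideal.span {f}) le_sup_left (e + k) _ ?_ ?_ ?_
  · intro p hp hpJ
    obtain ⟨i, hi, g, hg, rfl⟩ := Submodule.mem_sup.1 hpJ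
    obtain ⟨c, rfl⟩ := Ideal.mem_span_singleton'.1 hg
    rw [hmem]
    refine ⟨homogeneousComponent k c, homogeneousComponent_isHomogeneous k c, ?_⟩
    rw [← homogeneousComponent_eq_self hp, map_add, mul_comm c, hx_hc_mul hf, map_add,
      Ideal.Quotient.eq_zero_iff_mem.2 (hI i hi (e + k)), zero_add]
  · intro z hz
    obtain ⟨p, hp, rfl⟩ := (hmem z).1 hz
    exact hx_mem_gp.2 ⟨_, hf.mul hp, rfl⟩
  · intro z hz
    obtain ⟨p, hp, rfl⟩ := (hmem z).1 hz
    rw [Ideal.Quotient.factor_mk, Ideal.Quotient.eq_zero_iff_mem]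
    exact Ideal.mem_sup_right (Ideal.mul_mem_right _ _ (Ideal.mem_span_singleton_self f))

/-- Hilbert series. -/
def hxHS {N : ℕ} (I : Ideal (MvPolynomial (Fin N) ℂ)) : PowerSeries ℤ :=
  PowerSeries.mk fun k => (Module.finrank ℂ (gradedPiece I k) : ℤ)

theorem hxHS_step {N : ℕ} {I : Ideal (MvPolynomial (Fin N) ℂ)} (hI : HXHom I)
    {f : MvPolynomial (Fin N) ℂ} {e : ℕ} (hf : f.IsHomogeneous e) (hn : HXNzd f I) :
    hxHS (I ⊔ Ideal.span {f}) = (1 - PowerSeries.X ^ e) * hxHS I := by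
  ext k
  rw [sub_mul, one_mul, map_sub, PowerSeries.coeff_X_pow_mul']
  simp only [hxHS, PowerSeries.coeff_mk]
  split_ifs with h
  · obtain ⟨j, rfl⟩ := Nat.exists_eq_add_of_le h
    rw [hx_rank_ge hI hf hn j, Nat.add_sub_cancel_left]
    simp
  · rw [hx_rank_lt hI hf (not_le.1 h)]
    simp

theorem hxHS_reg {N : ℕ} {e : ℕ} (fs : List (MvPolynomial (Fin N) ℂ))
    (hfs : ∀ f ∈ fs, f.IsHomogeneous e) (I : Ideal (MvPolynomial (Fin N) ℂ)) (hI : HXHom I)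
    (hr : HXReg I fs) :
    hxHS (hxSpan I fs) = (1 - PowerSeries.X ^ e) ^ fs.length * hxHS I := by
  induction fs generalizing I with
  | nil => simp [hxSpan]
  | cons f fs ih =>
    have hf := hfs f (by simp)
    rw [hxSpan, ih (fun g hg => hfs g (by simp [hg])) _ (hI.sup hf) hr.2, hxHS_step hI hf hr.1,
      List.length_cons, pow_succ, mul_assoc]

theorem hxHS_range {N e : ℕ} (he : e ≠ 0) (f : Fin N → MvPolynomial (Fin N) ℂ)
    (hf : ∀ i, (f i).IsHomogeneous e) (hz : ∀ x, (∀ i, eval x (f i) = 0) → x = 0) :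
    hxHS (Ideal.span (Set.range f)) =
      (1 - PowerSeries.X ^ e) ^ N * hxHS (⊥ : Ideal (MvPolynomial (Fin N) ℂ)) := by
  have h1 : ∀ g ∈ List.ofFn f, g.IsHomogeneous e := by
    intro g hg
    obtain ⟨i, rfl⟩ := (List.mem_ofFn' f g).1 hg
    exact hf i
  have h2 := hx_reg e he N (List.ofFn f) (by simp) h1 (fun x hx => hz x fun i =>
    hx _ ((List.mem_ofFn' f _).2 ⟨i, rfl⟩))
  have h3 := hxHS_reg _ h1 ⊥ HXHom.bot h2
  rw [hxSpan_eq, bot_sup_eq, List.length_ofFn] at h3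
  rw [← h3]
  congr 2
  ext g
  exact (List.mem_ofFn' f g).symm

theorem hxHS_X {N : ℕ} :
    hxHS (Ideal.span (Set.range (X : Fin N → MvPolynomial (Fin N) ℂ))) = 1 := by
  have hX : ∀ i, (X i : MvPolynomial (Fin N) ℂ) ∈
      Ideal.span (Set.range (X : Fin N → MvPolynomial (Fin N) ℂ)) :=
    fun i => Ideal.subset_span ⟨i, rfl⟩
  have hle := hx_ker_eval_le hX
  have hge : Ideal.span (Set.range (X : Fin N → MvPolynomial (Fin N) ℂ)) ≤
      RingHom.ker (eval (0 : Fin N → ℂ)) := by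
    rw [Ideal.span_le]
    rintro _ ⟨i, rfl⟩
    simp [RingHom.mem_ker]
  ext k
  rw [hxHS, PowerSeries.coeff_mk, PowerSeries.coeff_one]
  split_ifs with hk
  · subst hk
    have : Module.finrank ℂ (gradedPiece
        (Ideal.span (Set.range (X : Fin N → MvPolynomial (Fin N) ℂ))) 0) = 1 := by
      refine finrank_eq_one ⟨1, hx_mem_gp.2 ⟨1, isHomogeneous_one _ _, map_one _⟩⟩ ?_ ?_
      · intro h
        have h' : (1 : MvPolynomial (Fin N) ℂ ⧸
          (Ideal.span (Set.range (X : Fin N → MvPolynomial (Fin N) ℂ)))) = 0 := congrArg Subtype.val h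
        rw [← map_one (Ideal.Quotient.mk _), Ideal.Quotient.eq_zero_iff_mem] at h'
        have := hge h'
        simp [RingHom.mem_ker] at this
      · rintro ⟨z, hz⟩
        obtain ⟨p, hp, rfl⟩ := hx_mem_gp.1 hz
        refine ⟨coeff 0 p, Subtype.ext ?_⟩
        have hpC : p = C (coeff 0 p) := by
          rw [← homogeneousComponent_zero, homogeneousComponent_eq_self hp]
        show coeff 0 p • (1 : MvPolynomial (Fin N) ℂ ⧸ _) = Ideal.Quotient.mk _ p
        refine Eq.trans ?_ (congrArg (Ideal.Quotient.mk _) hpC.symm)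
        have hC1 : C (coeff 0 p) = coeff 0 p • (1 : MvPolynomial (Fin N) ℂ) := by
          rw [smul_eq_C_mul, mul_one]
        rw [hC1]
        exact (map_smul (Ideal.Quotient.mkₐ ℂ (Ideal.span (Set.range
          (X : Fin N → MvPolynomial (Fin N) ℂ)))).toLinearMap (coeff 0 p) 1).symm
    rw [this]; simp
  · have : gradedPiece (Ideal.span (Set.range (X : Fin N → MvPolynomial (Fin N) ℂ))) k = ⊥ := by
      rw [eq_bot_iff]
      intro z hz
      obtain ⟨p, hp, rfl⟩ := hx_mem_gp.1 hz
      rw [Submodule.mem_bot, Ideal.Quotient.eq_zero_iff_mem]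
      apply hle
      have := hx_eval_smul hp 0 0
      rwa [zero_pow hk, zero_mul, smul_zero] at this
    rw [this]; simp

theorem hxHS_final {N e : ℕ} (he : e ≠ 0) (f : Fin N → MvPolynomial (Fin N) ℂ)
    (hf : ∀ i, (f i).IsHomogeneous e) (hz : ∀ x, (∀ i, eval x (f i) = 0) → x = 0) :
    hxHS (Ideal.span (Set.range f)) =
      (((∑ i ∈ Finset.range e, Polynomial.X ^ i) ^ N : Polynomial ℤ) : PowerSeries ℤ) := by
  have h1 := hxHS_range he f hf hz
  have h2 := hxHS_range one_ne_zero (X : Fin N → MvPolynomial (Fin N) ℂ)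
    (fun i => isHomogeneous_X ℂ i) (fun x hx => by funext i; simpa using hx i)
  rw [hxHS_X, pow_one] at h2
  have h3 : (1 - PowerSeries.X ^ e : PowerSeries ℤ) =
      ((∑ i ∈ Finset.range e, Polynomial.X ^ i : Polynomial ℤ) : PowerSeries ℤ)
        * (1 - PowerSeries.X) := by
    have := geom_sum_mul_neg (Polynomial.X : Polynomial ℤ) e
    have := congrArg (fun p : Polynomial ℤ => (p : PowerSeries ℤ)) this
    simpa using this.symm
  rw [h1, h3, mul_pow, mul_assoc, ← h2, mul_one, Polynomial.coe_pow]

theorem hx_palin (e N a b : ℕ) (hab : a + b = N * (e - 1)) :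
    ((∑ i ∈ Finset.range e, Polynomial.X ^ i : Polynomial ℤ) ^ N).coeff a =
    ((∑ i ∈ Finset.range e, Polynomial.X ^ i : Polynomial ℤ) ^ N).coeff b := by
  set p : Polynomial ℤ := ∑ i ∈ Finset.range e, Polynomial.X ^ i with hp
  have hdeg : p.natDegree ≤ e - 1 := by
    refine Polynomial.natDegree_sum_le_of_forall_le _ _ fun i hi => ?_
    rw [Polynomial.natDegree_X_pow]
    have := Finset.mem_range.1 hi
    omega
  have hcoeff : ∀ i, p.coeff i = if i < e then 1 else 0 := by
    intro i; simp [hp, Polynomial.coeff_X_pow]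
  have hrefl : p.reflect (e - 1) = p := by
    ext i
    rw [Polynomial.coeff_reflect, hcoeff, hcoeff]
    by_cases h : i ≤ e - 1
    · rw [Polynomial.revAt_le h]
      congr 1
      apply propext; omega
    · rw [Polynomial.revAt_eq_self_of_lt (by omega)]
  have key : ∀ M, (p ^ M).natDegree ≤ M * (e - 1) ∧ (p ^ M).reflect (M * (e - 1)) = p ^ M := by
    intro M
    induction M with
    | zero => simp
    | succ M ih =>
      refine ⟨Polynomial.natDegree_pow_le_of_le _ hdeg, ?_⟩
      rw [pow_succ, Nat.succ_mul, Polynomial.reflect_mul _ _ ih.1 hdeg, ih.2, hrefl]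
  have h := (key N).2
  conv_lhs => rw [← h]
  rw [Polynomial.coeff_reflect, ← hab, Polynomial.revAt_le (by omega)]
  congr 1
  omega

end Helpers



/-- For a smooth hypersurface of degree `d ≥ n+2` in `ℙ^{n+1}`, the graded pieces of the
Jacobian ring corresponding to `H^{n,0}` and `H^{0,n}` have the same dimension. -/
theorem hodge_extreme_graded_pieces_equidimensional
    (n d : ℕ) (hn : 1 ≤ n) (hd : n + 2 ≤ d)
    (F : MvPolynomial (Fin (n + 2)) ℂ) (hF : F.IsHomogeneous d)
    (hsmooth : ∀ x : Fin (n + 2) → ℂ, (∀ i, eval x (pderiv i F) = 0) → x = 0) :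
    Module.finrank ℂ (gradedPiece (jacobianIdeal F) (d - (n + 2)))
      = Module.finrank ℂ (gradedPiece (jacobianIdeal F) ((n + 1) * d - (n + 2))) := by
  have he : d - 1 ≠ 0 := by omega
  have hHS := hxHS_final (N := n + 2) he (fun i => pderiv i F) (fun i => hF.pderiv) hsmooth
  have hc : ∀ k, (Module.finrank ℂ (gradedPiece (jacobianIdeal F) k) : ℤ) =
      ((∑ i ∈ Finset.range (d - 1), Polynomial.X ^ i : Polynomial ℤ) ^ (n + 2)).coeff k := by
    intro k
    have := congrArg (PowerSeries.coeff k) hHS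
    rw [Polynomial.coeff_coe, hxHS, PowerSeries.coeff_mk] at this
    exact this
  have hab : (d - (n + 2)) + ((n + 1) * d - (n + 2)) = (n + 2) * (d - 1 - 1) := by
    obtain ⟨m, rfl⟩ := Nat.exists_eq_add_of_le hd
    have e1 : n + 2 + m - 1 - 1 = n + m := by omega
    have e2 : n + 2 + m - (n + 2) = m := by omega
    have e3 : (n + 1) * (n + 2 + m) = (n * (n + 2) + (n + 1) * m) + (n + 2) := by ring
    rw [e1, e2, e3, Nat.add_sub_cancel]
    ring
  have := hx_palin (d - 1) (n + 2) _ _ hab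
  rw [← hc, ← hc] at this
  exact_mod_cast this
end
end

section
/- For t ∈ ℂ, let F_t = x_0⁴ + x_1⁴ + x_2⁴ + x_3⁴ − t·x_0²x_1² ∈ ℂ[x_0,x_1,x_2,x_3]. Then the four partial derivatives ∂F_t/∂x_0,…,∂F_t/∂x_3 have a common zero in ℂ⁴ ∖ {0} if and only if t² = 4. In particular, for t = 2 the point (1,1,0,0) is a common zero of all four partial derivatives (so the quartic surface {F_2 = 0} ⊂ ℙ³ is singular at [1:1:0:0]), while for all t with t² ≠ 4 the quartic surface {F_t = 0} is smooth. -/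
noncomputable section

open MvPolynomial

/-- The family of quartic polynomials `F_t = x₀⁴ + x₁⁴ + x₂⁴ + x₃⁴ - t·x₀²x₁²`. -/
def quarticFamily (t : ℂ) : MvPolynomial (Fin 4) ℂ :=
  X 0 ^ 4 + X 1 ^ 4 + X 2 ^ 4 + X 3 ^ 4 - C t * (X 0 ^ 2 * X 1 ^ 2)

lemma quartic_grad (t : ℂ) (x : Fin 4 → ℂ) :
    (∀ i, eval x (pderiv i (quarticFamily t)) = 0) ↔
      (4 * x 0 ^ 3 - t * (2 * x 0 * x 1 ^ 2) = 0 ∧ 4 * x 1 ^ 3 - t * (2 * x 1 * x 0 ^ 2) = 0 ∧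
        x 2 = 0 ∧ x 3 = 0) := by
  have h0 : eval x (pderiv 0 (quarticFamily t)) = 4 * x 0 ^ 3 - t * (2 * x 0 * x 1 ^ 2) := by
    simp [quarticFamily, pderiv_X]
    left; ring
  have h1 : eval x (pderiv 1 (quarticFamily t)) = 4 * x 1 ^ 3 - t * (2 * x 1 * x 0 ^ 2) := by
    simp [quarticFamily, pderiv_X]
    left; ring
  have h2 : eval x (pderiv 2 (quarticFamily t)) = 4 * x 2 ^ 3 := by
    simp [quarticFamily, pderiv_X]
  have h3 : eval x (pderiv 3 (quarticFamily t)) = 4 * x 3 ^ 3 := by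
    simp [quarticFamily, pderiv_X]
  rw [Fin.forall_fin_succ, Fin.forall_fin_succ, Fin.forall_fin_succ, Fin.forall_fin_succ]
  change eval x (pderiv 0 (quarticFamily t)) = 0 ∧ eval x (pderiv 1 (quarticFamily t)) = 0 ∧
    eval x (pderiv 2 (quarticFamily t)) = 0 ∧ eval x (pderiv 3 (quarticFamily t)) = 0 ∧ _ ↔ _
  rw [h0, h1, h2, h3]
  simp

lemma quartic_smooth (t : ℂ) (ht : t ^ 2 ≠ 4) (x : Fin 4 → ℂ)
    (h : ∀ i, eval x (pderiv i (quarticFamily t)) = 0) : x = 0 := by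
  rw [quartic_grad] at h
  obtain ⟨h0, h1, h2, h3⟩ := h
  have key : x 0 = 0 ∧ x 1 = 0 := by
    by_cases ha : x 0 = 0
    · refine ⟨ha, ?_⟩
      simpa [ha] using h1
    · exfalso
      by_cases hb : x 1 = 0
      · simp [hb, ha] at h0
      · have e0 : 2 * x 0 ^ 2 - t * x 1 ^ 2 = 0 := by
          apply mul_left_cancel₀ (mul_ne_zero two_ne_zero ha)
          linear_combination h0
        have e1 : 2 * x 1 ^ 2 - t * x 0 ^ 2 = 0 := by
          apply mul_left_cancel₀ (mul_ne_zero two_ne_zero hb)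
          linear_combination h1
        apply ht
        apply mul_right_cancel₀ (pow_ne_zero 2 ha)
        linear_combination -2 * e0 - t * e1
  funext i
  fin_cases i
  exacts [key.1, key.2, h2, h3]

/-- The partial derivatives of `F_t` have a common zero in `ℂ⁴ ∖ {0}` iff `t² = 4`. In
particular for `t = 2` the point `(1,1,0,0)` is a common zero (so `{F_2 = 0}` is singular at
`[1:1:0:0]`), while for `t² ≠ 4` the quartic surface `{F_t = 0} ⊂ ℙ³` is smooth. -/
theorem quartic_family_singular_iff :
    (∀ t : ℂ,
      (∃ x : Fin 4 → ℂ, x ≠ 0 ∧ ∀ i, eval x (pderiv i (quarticFamily t)) = 0) ↔ t ^ 2 = 4) ∧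
    (∀ i, eval (![1, 1, 0, 0] : Fin 4 → ℂ) (pderiv i (quarticFamily 2)) = 0) ∧
    (∀ t : ℂ, t ^ 2 ≠ 4 →
      ∀ x : Fin 4 → ℂ, (∀ i, eval x (pderiv i (quarticFamily t)) = 0) → x = 0) := by
  refine ⟨fun t => ⟨?_, fun ht => ?_⟩, ?_, quartic_smooth⟩
  · rintro ⟨x, hx, h⟩
    by_contra ht
    exact hx (quartic_smooth t ht x h)
  · have h : (t - 2) * (t + 2) = 0 := by linear_combination ht
    rcases mul_eq_zero.mp h with h | h
    · obtain rfl : t = 2 := by linear_combination h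
      refine ⟨![1, 1, 0, 0], fun h => by simpa using congrFun h 0, ?_⟩
      rw [quartic_grad]
      refine ⟨?_, ?_, rfl, rfl⟩ <;> norm_num
    · obtain rfl : t = -2 := by linear_combination h
      refine ⟨![1, Complex.I, 0, 0], fun h => by simpa using congrFun h 0, ?_⟩
      rw [quartic_grad]
      simp [pow_succ]
      constructor <;> ring
  · rw [quartic_grad]
    refine ⟨?_, ?_, rfl, rfl⟩ <;> norm_num
end
end
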